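/- For k ∈ {2, 3}, every connected graph G of order n with rvd(G) = k satisfies |E(G)| ≤ ⌊(k+1)(n−1)/2⌋. Moreover, for k = 2 and every n ≥ 3 there exists a connected graph G of order n with rvd(G) = 2 and |E(G)| = ⌊3(n−1)/2⌋, and for k = 3 and every n ≥ 5 with n ≡ 1 (mod 4) there exists a connected graph G of order n with rvd(G) = 3 and |E(G)| = 2(n−1). -/

import Mathlib

open SimpleGraph

/-- A set of vertices is rainbow under a coloring `c` if no two of its vertices
receive the same color. -/
def RainbowSet {V : Type*} (c : V → ℕ) (S : Set V) : Prop := Set.InjOn c S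

/-- `c` is a rainbow vertex-disconnection coloring of `G`: for every two distinct
vertices `x, y` there is a set `S` avoiding `x` and `y` such that every `x`-`y` walk
in `G - xy` (which is `G` itself when `x, y` are nonadjacent) meets `S` (i.e. `S` is
an `x`-`y` vertex-cut), and moreover `S` is rainbow when `x, y` are nonadjacent,
while `S ∪ {x}` or `S ∪ {y}` is rainbow when `x, y` are adjacent. -/
def IsRVDColoring {V : Type*} (G : SimpleGraph V) (c : V → ℕ) : Prop :=
  ∀ x y : V, x ≠ y → ∃ S : Set V, x ∉ S ∧ y ∉ S ∧
    (∀ p : (G.deleteEdges {s(x, y)}).Walk x y, ∃ v ∈ p.support, v ∈ S) ∧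
    (¬ G.Adj x y → RainbowSet c S) ∧
    (G.Adj x y → (RainbowSet c (insert x S) ∨ RainbowSet c (insert y S)))

/-- The rainbow vertex-disconnection number `rvd G`: the minimum number of colors
used by a rainbow vertex-disconnection coloring of `G`. -/
noncomputable def rvd {V : Type*} (G : SimpleGraph V) : ℕ :=
  sInf {k | ∃ c : V → ℕ, IsRVDColoring G c ∧ (Set.range c).ncard = k}

section ThreePaths

open Classical Finset

variable {V : Type*}

/-- The graph obtained from `G` by discarding all edges not inside `Y`. -/
def restrictTo (G : SimpleGraph V) (Y : Finset V) : SimpleGraph V where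
  Adj a b := G.Adj a b ∧ a ∈ Y ∧ b ∈ Y
  symm := ⟨fun _ _ h => ⟨h.1.symm, h.2.2, h.2.1⟩⟩
  loopless := ⟨fun _ h => G.loopless.irrefl _ h.1⟩

/-- The graph obtained from `G` by joining `u` and `v`. -/
def addEdge (G : SimpleGraph V) (u v : V) : SimpleGraph V where
  Adj a b := G.Adj a b ∨ (u ≠ v ∧ (a = u ∧ b = v ∨ a = v ∧ b = u))
  symm := ⟨fun _ _ h => by
    rcases h with h | h
    · exact Or.inl h.symm
    · exact Or.inr (by tauto)⟩
  loopless := ⟨fun a h => by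
    rcases h with h | ⟨h, ⟨rfl, rfl⟩ | ⟨rfl, rfl⟩⟩
    · exact G.loopless.irrefl _ h
    · exact h rfl
    · exact h rfl⟩

/-- The graph obtained from `G` by separating `u` and `v`. -/
def removeEdge (G : SimpleGraph V) (u v : V) : SimpleGraph V where
  Adj a b := G.Adj a b ∧ ¬ (a = u ∧ b = v) ∧ ¬ (a = v ∧ b = u)
  symm := ⟨fun _ _ h => ⟨h.1.symm, by tauto⟩⟩
  loopless := ⟨fun _ h => G.loopless.irrefl _ h.1⟩

lemma restrictTo_adj {G : SimpleGraph V} {Y : Finset V} {a b : V} :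
    (restrictTo G Y).Adj a b ↔ G.Adj a b ∧ a ∈ Y ∧ b ∈ Y := Iff.rfl

lemma addEdge_adj {G : SimpleGraph V} {u v a b : V} :
    (addEdge G u v).Adj a b ↔ G.Adj a b ∨ (u ≠ v ∧ (a = u ∧ b = v ∨ a = v ∧ b = u)) := Iff.rfl

lemma removeEdge_adj {G : SimpleGraph V} {u v a b : V} :
    (removeEdge G u v).Adj a b ↔ G.Adj a b ∧ ¬ (a = u ∧ b = v) ∧ ¬ (a = v ∧ b = u) := Iff.rfl

/-- The number of neighbours of `v` in `Y`. -/
noncomputable def degIn (G : SimpleGraph V) (Y : Finset V) (v : V) : ℕ := #{w ∈ Y | G.Adj v w}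

lemma degIn_lt_card {G : SimpleGraph V} {X : Finset V} {v : V} (hv : v ∈ X) :
    degIn G X v + 1 ≤ #X := by
  have : #{w ∈ X | G.Adj v w} < #X :=
    card_lt_card (filter_ssubset.2 ⟨v, hv, G.loopless.irrefl v⟩)
  exact this

lemma addEdge_eq_self {G : SimpleGraph V} {u v : V} (h : G.Adj u v) : addEdge G u v = G := by
  ext a b
  have := h.symm
  rw [addEdge_adj]
  grind

section Counting

variable [Fintype V]

/-- Twice the number of edges, counted as ordered adjacent pairs. -/
noncomputable def arcs (G : SimpleGraph V) : ℕ := ∑ p : V × V, if G.Adj p.1 p.2 then 1 else 0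

lemma arcs_eq_sum (G : SimpleGraph V) : arcs G = ∑ v, degIn G univ v := by
  simp only [arcs, degIn, Fintype.sum_prod_type, Finset.card_filter]

lemma arcs_eq_two_mul (G : SimpleGraph V) : arcs G = 2 * G.edgeSet.ncard := by
  have h1 := G.sum_degrees_eq_twice_card_edges
  rw [arcs_eq_sum, Set.ncard_eq_toFinset_card', Set.toFinset_card, ← SimpleGraph.edgeFinset_card, ← h1]
  refine Finset.sum_congr rfl fun v _ => ?_
  rw [degIn, ← SimpleGraph.card_neighborFinset_eq_degree]
  congr 1
  ext w
  simp

lemma even_arcs (G : SimpleGraph V) : 2 ∣ arcs G := ⟨_, arcs_eq_two_mul G⟩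

lemma arcs_eq_sum_of_support {G : SimpleGraph V} {X : Finset V}
    (hX : ∀ a b, G.Adj a b → a ∈ X) : arcs G = ∑ v ∈ X, degIn G univ v := by
  rw [arcs_eq_sum]
  refine (Finset.sum_subset (subset_univ X) fun v _ hv => ?_).symm
  simp only [degIn, card_eq_zero, filter_eq_empty_iff]
  exact fun w _ h => hv (hX _ _ h)

lemma degIn_eq_of_support {G : SimpleGraph V} {X : Finset V}
    (hX : ∀ a b, G.Adj a b → a ∈ X) (v : V) : degIn G univ v = degIn G X v := by
  unfold degIn
  congr 1
  ext w
  simp only [mem_filter, mem_univ, true_and]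
  exact ⟨fun h => ⟨hX _ _ h.symm, h⟩, fun h => h.2⟩

lemma arcs_restrictTo_add {G : SimpleGraph V} {A B S : Finset V}
    (hX : ∀ a b, G.Adj a b → a ∈ A ∨ a ∈ B ∨ a ∈ S) (hAB : ∀ v ∈ A, v ∉ B)
    (hE : ∀ a ∈ A, ∀ b ∈ B, ¬ G.Adj a b) (hAS : ∀ v ∈ A, v ∉ S) :
    arcs (restrictTo G (A ∪ S)) + arcs (restrictTo G (B ∪ S)) = arcs G + arcs (restrictTo G S) := by
  simp only [arcs, ← Finset.sum_add_distrib]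
  refine Finset.sum_congr rfl fun p _ => ?_
  obtain ⟨a, b⟩ := p
  simp only [restrictTo_adj, mem_union]
  by_cases h : G.Adj a b
  · have h1 := hX _ _ h
    have h2 := hX _ _ h.symm
    have h3 := hE a
    have h4 := hE b
    have h5 := h.symm
    grind
  · simp [h]

lemma arcs_addEdge {G : SimpleGraph V} {u v : V} (huv : u ≠ v) (h : ¬ G.Adj u v) :
    arcs (addEdge G u v) = arcs G + 2 := by
  have h2 : (2 : ℕ) = ∑ p : V × V, ((if p = (u, v) then 1 else 0) + if p = (v, u) then 1 else 0) := by
    simp [Finset.sum_add_distrib]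
  rw [h2, arcs, arcs, ← Finset.sum_add_distrib]
  refine Finset.sum_congr rfl fun p _ => ?_
  obtain ⟨a, b⟩ := p
  have h' : ¬ G.Adj v u := fun h1 => h h1.symm
  simp only [addEdge_adj, Prod.mk.injEq]
  grind

lemma arcs_mono {G H : SimpleGraph V} (h : ∀ a b, G.Adj a b → H.Adj a b) : arcs G ≤ arcs H := by
  refine Finset.sum_le_sum fun p _ => ?_
  have := h p.1 p.2
  grind

lemma arcs_removeEdge {G : SimpleGraph V} {u v : V} (h : G.Adj u v) :
    arcs (removeEdge G u v) + 2 = arcs G := by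
  rw [← arcs_addEdge h.ne (by simp [removeEdge_adj])]
  congr 1
  ext a b
  have := h.symm
  have := h.ne
  rw [addEdge_adj, removeEdge_adj]
  grind

lemma arcs_restrictTo_insert {G : SimpleGraph V} {Y : Finset V} {s : V} (hs : s ∉ Y) :
    arcs (restrictTo G (insert s Y)) = arcs (restrictTo G Y) + 2 * degIn G Y s := by
  have h1 : degIn G Y s = ∑ p : V × V, if p.1 = s ∧ p.2 ∈ Y ∧ G.Adj s p.2 then 1 else 0 := by
    rw [← Finset.card_filter, degIn]
    refine Finset.card_bij (fun w _ => (s, w)) ?_ ?_ ?_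
    · simp
    · simp
    · rintro ⟨a, b⟩
      simp
      grind
  have h2 : degIn G Y s = ∑ p : V × V, if p.2 = s ∧ p.1 ∈ Y ∧ G.Adj s p.1 then 1 else 0 := by
    rw [← Finset.card_filter, degIn]
    refine Finset.card_bij (fun w _ => (w, s)) ?_ ?_ ?_
    · simp
    · simp
    · rintro ⟨a, b⟩
      simp
      grind
  rw [two_mul]
  nth_rw 1 [h1]
  rw [h2, arcs, arcs, ← Finset.sum_add_distrib, ← Finset.sum_add_distrib]
  refine Finset.sum_congr rfl fun p _ => ?_
  obtain ⟨a, b⟩ := p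
  have h3 := G.adj_comm a b
  have h4 := G.loopless.irrefl a
  simp only [restrictTo_adj, mem_insert]
  grind

lemma arcs_restrictTo_singleton {G : SimpleGraph V} {s : V} : arcs (restrictTo G {s}) = 0 := by
  refine Finset.sum_eq_zero fun p _ => ?_
  have h4 := G.loopless.irrefl s
  simp only [restrictTo_adj, mem_singleton]
  grind

lemma arcs_restrictTo_triple {G : SimpleGraph V} {a b c : V} (hab : a ≠ b) (hac : a ≠ c)
    (hbc : b ≠ c) : arcs (restrictTo G {a, b, c}) = 2 * ((if G.Adj a b then 1 else 0) +
      (if G.Adj a c then 1 else 0) + (if G.Adj b c then 1 else 0)) := by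
  rw [arcs_restrictTo_insert (by simp [hab, hac]), arcs_restrictTo_insert (by simp [hbc]),
    arcs_restrictTo_singleton]
  simp only [degIn, Finset.filter_insert, Finset.filter_singleton]
  split_ifs <;> simp_all

end Counting

/-- `x` and `y` are separated by a vertex-cut of size at most `k`, or at most `k - 1` and the
edge `xy` when they are adjacent. -/
def SmallCut (k : ℕ) (G : SimpleGraph V) (x y : V) : Prop :=
  ∃ A T : Finset V, x ∈ A ∧ x ∉ T ∧ y ∉ A ∧ y ∉ T ∧
    (∀ a b, a ∈ A → a ∉ T → b ∉ A → b ∉ T → G.Adj a b → a = x ∧ b = y) ∧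
    #T + (if G.Adj x y then 1 else 0) ≤ k

/-- Every two distinct vertices have a small cut. -/
def HasSmallCuts (k : ℕ) (G : SimpleGraph V) : Prop := ∀ x y, x ≠ y → SmallCut k G x y

/-- No set of at most `k` vertices separates two vertices of `X`. -/
def NoSep (k : ℕ) (G : SimpleGraph V) (X : Finset V) : Prop :=
  ∀ A T : Finset V, #T ≤ k → (∃ a ∈ X, a ∈ A ∧ a ∉ T) → (∃ b ∈ X, b ∉ A ∧ b ∉ T) →
    ∃ a ∈ X, ∃ b ∈ X, a ∈ A ∧ a ∉ T ∧ b ∉ A ∧ b ∉ T ∧ G.Adj a b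

/-- `X` is the disjoint union of `A`, `B`, `S`, with `A` and `B` nonempty and without edges
between them. -/
structure Separation (G : SimpleGraph V) (X A B S : Finset V) : Prop where
  mem : ∀ v, v ∈ X ↔ v ∈ A ∨ v ∈ B ∨ v ∈ S
  disjAB : ∀ v ∈ A, v ∉ B
  disjAS : ∀ v ∈ A, v ∉ S
  disjBS : ∀ v ∈ B, v ∉ S
  no_edge : ∀ a ∈ A, ∀ b ∈ B, ¬ G.Adj a b
  left : A.Nonempty
  right : B.Nonempty

/-- `s` is adjacent to every union of components of `G[D]`. -/
def Attached (G : SimpleGraph V) (D : Finset V) (s : V) : Prop :=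
  ∀ Z ⊆ D, Z.Nonempty → (∀ z ∈ Z, ∀ d ∈ D, d ∉ Z → ¬ G.Adj z d) → ∃ z ∈ Z, G.Adj z s

lemma Separation.symm {G : SimpleGraph V} {X A B S : Finset V} (h : Separation G X A B S) :
    Separation G X B A S where
  mem v := by rw [h.mem]; tauto
  disjAB v h1 h2 := h.disjAB v h2 h1
  disjAS := h.disjBS
  disjBS := h.disjAS
  no_edge a ha b hb hab := h.no_edge b hb a ha hab.symm
  left := h.right
  right := h.left

lemma Separation.card {G : SimpleGraph V} {X A B S : Finset V} (h : Separation G X A B S) :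
    #X = #A + #B + #S := by
  have : X = (A ∪ B) ∪ S := by
    ext v; simp [h.mem]
  rw [this, card_union_of_disjoint, card_union_of_disjoint]
  · exact Finset.disjoint_left.2 h.disjAB
  · rw [Finset.disjoint_left]
    intro v hv
    rcases mem_union.1 hv with hv | hv
    · exact h.disjAS v hv
    · exact h.disjBS v hv

lemma Separation.card_left_union {G : SimpleGraph V} {X A B S : Finset V}
    (h : Separation G X A B S) : #(A ∪ S) = #A + #S :=
  card_union_of_disjoint (Finset.disjoint_left.2 h.disjAS)

lemma Separation.mono {G H : SimpleGraph V} {X A B S : Finset V} (h : Separation G X A B S)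
    (hGH : ∀ a b, H.Adj a b → G.Adj a b) : Separation H X A B S :=
  ⟨h.mem, h.disjAB, h.disjAS, h.disjBS, fun a ha b hb hab => h.no_edge a ha b hb (hGH _ _ hab),
    h.left, h.right⟩

lemma exists_separation_of_not_noSep {k : ℕ} {G : SimpleGraph V} {X : Finset V}
    (h : ¬ NoSep k G X) : ∃ A B S, Separation G X A B S ∧ #S ≤ k := by
  unfold NoSep at h
  push Not at h
  obtain ⟨A, T, hT, ⟨a, haX, haA, haT⟩, ⟨b, hbX, hbA, hbT⟩, hE⟩ := h
  refine ⟨{v ∈ X | v ∈ A ∧ v ∉ T}, {v ∈ X | v ∉ A ∧ v ∉ T}, {v ∈ X | v ∈ T},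
    ⟨?_, ?_, ?_, ?_, ?_, ⟨a, by simp [*]⟩, ⟨b, by simp [*]⟩⟩, ?_⟩
  · intro v; simp; tauto
  · intro v; simp; tauto
  · intro v; simp; tauto
  · intro v; simp; tauto
  · intro v hv w hw
    simp only [mem_filter] at hv hw
    exact hE v hv.1 w hw.1 hv.2.1 hv.2.2 hw.2.1 hw.2.2
  · refine (card_le_card ?_).trans hT
    intro v; simp

lemma NoSep.lt_card {k : ℕ} {G : SimpleGraph V} {X A B S : Finset V} (h : NoSep k G X)
    (hs : Separation G X A B S) : k < #S := by
  by_contra! hk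
  obtain ⟨a, ha⟩ := hs.left
  obtain ⟨b, hb⟩ := hs.right
  obtain ⟨v, hvX, w, hwX, hv, hvS, hw, hwS, hvw⟩ := h A S hk
    ⟨a, (hs.mem a).2 (Or.inl ha), ha, hs.disjAS a ha⟩
    ⟨b, (hs.mem b).2 (Or.inr (Or.inl hb)), fun h1 => hs.disjAB b h1 hb, hs.disjBS b hb⟩
  have := (hs.mem w).1 hwX
  exact hs.no_edge v hv w (by tauto) hvw

lemma NoSep.mono {k l : ℕ} {G : SimpleGraph V} {X : Finset V} (h : NoSep k G X) (hl : l ≤ k) :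
    NoSep l G X := fun A T hT => h A T (hT.trans hl)

lemma SmallCut.symm [Fintype V] {k : ℕ} {G : SimpleGraph V} {x y : V} (h : SmallCut k G x y) :
    SmallCut k G y x := by
  obtain ⟨A, T, hxA, hxT, hyA, hyT, hE, hk⟩ := h
  refine ⟨Aᶜ, T, by simpa, hyT, by simpa, hxT, ?_, ?_⟩
  · intro a b ha haT hb hbT hab
    simp only [mem_compl, not_not] at ha hb
    exact (hE b a hb hbT ha haT hab.symm).symm
  · simpa only [G.adj_comm] using hk

lemma SmallCut.of_isolated [Fintype V] {k : ℕ} {G : SimpleGraph V} {x y : V} (hxy : x ≠ y)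
    (h : ∀ v, ¬ G.Adj x v) : SmallCut k G x y :=
  ⟨{x}, ∅, by simp, by simp, by simpa using hxy.symm, by simp,
    fun a b ha _ _ _ hab => absurd (mem_singleton.1 ha ▸ hab) (h b), by simp [h y]⟩

lemma hasSmallCuts_of_support [Fintype V] {k : ℕ} {G : SimpleGraph V} {X : Finset V}
    (hX : ∀ a b, G.Adj a b → a ∈ X) (h : ∀ x ∈ X, ∀ y ∈ X, x ≠ y → SmallCut k G x y) :
    HasSmallCuts k G := by
  intro x y hxy
  by_cases hx : x ∈ X
  · by_cases hy : y ∈ X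
    · exact h x hx y hy hxy
    · exact (SmallCut.of_isolated hxy.symm fun v hv => hy (hX _ _ hv)).symm
  · exact SmallCut.of_isolated hxy fun v hv => hx (hX _ _ hv)

lemma HasSmallCuts.mono {k : ℕ} {G H : SimpleGraph V} (h : HasSmallCuts k G)
    (hGH : ∀ a b, H.Adj a b → G.Adj a b) : HasSmallCuts k H := by
  intro x y hxy
  obtain ⟨A, T, hxA, hxT, hyA, hyT, hE, hk⟩ := h x y hxy
  refine ⟨A, T, hxA, hxT, hyA, hyT, fun a b h1 h2 h3 h4 h5 => hE a b h1 h2 h3 h4 (hGH _ _ h5), ?_⟩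
  have := hGH x y
  grind

/-- Adjacent or common neighbours are in every cut. -/
lemma HasSmallCuts.card_common_le {k : ℕ} {G : SimpleGraph V} (h : HasSmallCuts k G) {x y : V}
    (hxy : x ≠ y) (C : Finset V) (hC : ∀ v ∈ C, G.Adj v x ∧ G.Adj v y) :
    #C + (if G.Adj x y then 1 else 0) ≤ k := by
  obtain ⟨A, T, hxA, hxT, hyA, hyT, hE, hk⟩ := h x y hxy
  refine le_trans (Nat.add_le_add_right (card_le_card fun v hv => ?_) _) hk
  have h1 := hC v hv
  have h2 := hE x v hxA hxT
  have h3 := hE v y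
  have h4 := h1.1.symm
  have h5 := h1.1.ne
  have h6 := h1.2.ne
  tauto

/-- A nonempty set attached to several vertices and missed by a cut lies on one side of it. -/
lemma same_side {G : SimpleGraph V} {A T D : Finset V} {x y : V}
    (hE : ∀ a b, a ∈ A → a ∉ T → b ∉ A → b ∉ T → G.Adj a b → a = x ∧ b = y)
    (hx : x ∉ D) (hy : y ∉ D) (hD : D.Nonempty) (hTD : ∀ t ∈ T, t ∉ D) :
    (∀ s, Attached G D s → s ∈ A ∨ s ∈ T) ∨ (∀ s, Attached G D s → s ∉ A ∨ s ∈ T) := by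
  by_cases hZ : ∃ d ∈ D, d ∈ A
  · left
    intro s hs
    obtain ⟨d, hd, hdA⟩ := hZ
    obtain ⟨z, hz, hzs⟩ := hs (D.filter (· ∈ A)) (filter_subset _ _) ⟨d, by simp [hd, hdA]⟩ (by
      intro z hz d hd hdz hzd
      simp only [mem_filter, not_and] at hz hdz
      have := hE z d hz.2 (fun h => hTD z h hz.1) (hdz hd) (fun h => hTD d h hd) hzd
      exact hx (this.1 ▸ hz.1))
    simp only [mem_filter] at hz
    by_contra! hc
    have := hE z s hz.2 (fun h => hTD z h hz.1) hc.1 hc.2 hzs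
    exact hx (this.1 ▸ hz.1)
  · right
    push Not at hZ
    intro s hs
    obtain ⟨z, hz, hzs⟩ := hs D subset_rfl hD (by intro _ _ d hd hd'; exact absurd hd hd')
    by_contra! hc
    have := hE s z hc.1 hc.2 (hZ z hz) (fun h => hTD z h hz) hzs.symm
    exact hy (this.2 ▸ hz)

lemma NoSep.attached {k : ℕ} {G : SimpleGraph V} {X D S : Finset V} (h : NoSep k G X)
    (hD : D ⊆ X) (hS : S ⊆ X) (hDS : ∀ v ∈ D, v ∉ S) (hk : #S ≤ k + 1)
    (hN : ∀ d ∈ D, ∀ v, G.Adj d v → v ∈ D ∨ v ∈ S) {s : V} (hs : s ∈ S) : Attached G D s := by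
  intro Z hZD hZ hcl
  by_contra! hc
  obtain ⟨z, hz⟩ := hZ
  obtain ⟨a, haX, b, hbX, ha, haT, hb, hbT, hab⟩ := h Z (S.erase s)
    (by rw [card_erase_of_mem hs]; omega)
    ⟨z, hD (hZD hz), hz, fun h1 => hDS z (hZD hz) (mem_of_mem_erase h1)⟩
    ⟨s, hS hs, fun h1 => hDS s (hZD h1) hs, by simp⟩
  rcases hN a (hZD ha) b hab with h1 | h1
  · exact hcl a ha b h1 hb hab
  · have : b = s := by
      by_contra hbs
      exact hbT (mem_erase.2 ⟨hbs, h1⟩)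
    exact hc a ha (this ▸ hab)

lemma NoSep.attached_of_separation {k : ℕ} {G : SimpleGraph V} {X A B S : Finset V}
    (h : NoSep k G X) (hX : ∀ a b, G.Adj a b → a ∈ X) (hs : Separation G X A B S)
    (hk : #S ≤ k + 1) {s : V} (hsS : s ∈ S) : Attached G B s := by
  refine h.attached (fun v hv => (hs.mem v).2 (by tauto)) (fun v hv => (hs.mem v).2 (by tauto))
    hs.disjBS hk (fun d hd v hdv => ?_) hsS
  have h1 := (hs.mem v).1 (hX _ _ hdv.symm)
  have h2 := fun h => hs.no_edge v h d hd hdv.symm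
  tauto

/-- In a graph without small separations, a small separation of the part `A ∪ S` divides `S`. -/
lemma NoSep.divides {k : ℕ} {G : SimpleGraph V} {X A B S C T : Finset V} (h : NoSep k G X)
    (hs : Separation G X A B S) (hk : #(T ∩ (A ∪ S)) ≤ k) (hC : ∃ v ∈ A ∪ S, v ∉ C ∧ v ∉ T)
    (hE : ∀ a ∈ A ∪ S, ∀ b ∈ A ∪ S, a ∈ C → a ∉ T → b ∉ C → b ∉ T → ¬ G.Adj a b) :
    ¬ ∀ s ∈ S, s ∈ C ∨ s ∈ T := by
  intro hSC
  obtain ⟨v, hv, hvC, hvT⟩ := hC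
  obtain ⟨z, hz⟩ := hs.right
  have hz1 := hs.disjAB z
  have hz2 := hs.disjBS z
  obtain ⟨a, haX, b, hbX, ha, haT, hb, hbT, hab⟩ := h (B ∪ C) (T ∩ (A ∪ S)) hk
    ⟨z, (hs.mem z).2 (by tauto), by simp [hz], by simp; tauto⟩
    ⟨v, (hs.mem v).2 (by simp at hv; tauto), by
      have := hs.disjAB v
      have := hSC v
      simp at hv ⊢; tauto, by simp [hvT]⟩
  have h1 := (hs.mem a).1 haX
  have h2 := (hs.mem b).1 hbX
  have h3 := hs.no_edge b
  have h4 := hE a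
  have h5 := hSC b
  have h6 := hab.symm
  have h7 := hs.disjAB a
  have h8 := hs.disjBS a
  simp only [mem_union, mem_inter, not_and, not_or] at *
  grind

lemma NoSep.exists_divided [Fintype V] {k : ℕ} {G : SimpleGraph V} {X A B S C T : Finset V}
    (h : NoSep k G X) (hs : Separation G X A B S) (hk : #(T ∩ (A ∪ S)) ≤ k) (hC : ∃ v ∈ A ∪ S, v ∈ C ∧ v ∉ T)
    (hC' : ∃ v ∈ A ∪ S, v ∉ C ∧ v ∉ T)
    (hE : ∀ a ∈ A ∪ S, ∀ b ∈ A ∪ S, a ∈ C → a ∉ T → b ∉ C → b ∉ T → ¬ G.Adj a b) :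
    (∃ s ∈ S, s ∈ C ∧ s ∉ T) ∧ ∃ s ∈ S, s ∉ C ∧ s ∉ T := by
  constructor
  · have := h.divides (C := Cᶜ) hs hk (by simpa using hC) (fun a ha b hb h1 h2 h3 h4 h5 =>
      hE b hb a ha (by simpa using h3) h4 (by simpa using h1) h2 h5.symm)
    push Not at this
    simpa using this
  · have := h.divides hs hk hC' hE
    push Not at this
    exact this

section Bounds

variable [Fintype V]

lemma HasSmallCuts.restrictTo_addEdge {k : ℕ} {G : SimpleGraph V} (h : HasSmallCuts k G)
    {Y D : Finset V} {u w : V} (huw : u ≠ w) (hu : u ∈ Y) (hw : w ∈ Y) (hYD : ∀ v ∈ Y, v ∉ D)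
    (hD : D.Nonempty) (huD : Attached G D u) (hwD : Attached G D w) :
    HasSmallCuts k (addEdge (restrictTo G Y) u w) := by
  refine hasSmallCuts_of_support (X := Y) (fun a b hab => ?_) fun x hx y hy hxy => ?_
  · rw [addEdge_adj, restrictTo_adj] at hab
    grind
  obtain ⟨A, T, hxA, hxT, hyA, hyT, hE, hk⟩ := h x y hxy
  by_cases hTD : ∀ t ∈ T, t ∉ D
  · have hs := same_side hE (hYD x hx) (hYD y hy) hD hTD
    have hs' : (u ∈ A ∨ u ∈ T) ∧ (w ∈ A ∨ w ∈ T) ∨ (u ∉ A ∨ u ∈ T) ∧ (w ∉ A ∨ w ∈ T) :=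
      hs.imp (fun h => ⟨h u huD, h w hwD⟩) (fun h => ⟨h u huD, h w hwD⟩)
    refine ⟨A, T, hxA, hxT, hyA, hyT, ?_, ?_⟩
    · intro a b h1 h2 h3 h4 h5
      rw [addEdge_adj, restrictTo_adj] at h5
      rcases h5 with h5 | h5
      · exact hE a b h1 h2 h3 h4 h5.1
      · grind
    · simp only [addEdge_adj, restrictTo_adj]
      grind
  · push Not at hTD
    obtain ⟨t, ht, htD⟩ := hTD
    have hlt : #(T ∩ Y) + 1 ≤ #T := card_lt_card ⟨inter_subset_left, fun h1 =>
      hYD t (mem_inter.1 (h1 ht)).2 htD⟩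
    by_cases he : (x = u ∧ y = w) ∨ (x = w ∧ y = u)
    · refine ⟨A, T ∩ Y, hxA, by simp [hxT], hyA, by simp [hyT], ?_, ?_⟩
      · intro a b h1 h2 h3 h4 h5
        have := hE a b h1
        rw [addEdge_adj, restrictTo_adj] at h5
        simp only [mem_inter] at h2 h4
        grind
      · split_ifs <;> omega
    · obtain ⟨r, hr, hrx, hry⟩ : ∃ r, (r = u ∨ r = w) ∧ x ≠ r ∧ y ≠ r := by
        by_cases hr : x ≠ u ∧ y ≠ u
        · exact ⟨u, Or.inl rfl, hr.1, hr.2⟩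
        · exact ⟨w, Or.inr rfl, by grind, by grind⟩
      refine ⟨A, insert r (T ∩ Y), hxA, by simp [hxT, hrx], hyA, by simp [hyT, hry], ?_, ?_⟩
      · intro a b h1 h2 h3 h4 h5
        have := hE a b h1
        rw [addEdge_adj, restrictTo_adj] at h5
        simp only [mem_inter, mem_insert] at h2 h4
        grind
      · have := card_insert_le r (T ∩ Y)
        simp only [addEdge_adj, restrictTo_adj]
        grind

/-- `G[Y]` together with a vertex `s` joined to `a`, `b` and `c`. -/
def addStar (G : SimpleGraph V) (Y : Finset V) (s a b c : V) : SimpleGraph V :=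
  addEdge (addEdge (addEdge (restrictTo G Y) s a) s b) s c

omit [Fintype V] in
lemma addStar_adj {G : SimpleGraph V} {Y : Finset V} {s a b c : V} (hs : s ∉ Y) (ha : a ∈ Y)
    (hb : b ∈ Y) (hc : c ∈ Y) {x y : V} : (addStar G Y s a b c).Adj x y ↔
      G.Adj x y ∧ x ∈ Y ∧ y ∈ Y ∨ x = s ∧ (y = a ∨ y = b ∨ y = c) ∨
        y = s ∧ (x = a ∨ x = b ∨ x = c) := by
  simp only [addStar, addEdge_adj, restrictTo_adj]
  grind

lemma arcs_addStar {G : SimpleGraph V} {Y : Finset V} {s a b c : V} (hs : s ∉ Y) (ha : a ∈ Y)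
    (hb : b ∈ Y) (hc : c ∈ Y) (hab : a ≠ b) (hac : a ≠ c) (hbc : b ≠ c) :
    arcs (addStar G Y s a b c) = arcs (restrictTo G Y) + 6 := by
  rw [addStar, arcs_addEdge, arcs_addEdge, arcs_addEdge]
  all_goals
    try simp only [addEdge_adj, restrictTo_adj]
    grind

lemma HasSmallCuts.addStar {G : SimpleGraph V} (h : HasSmallCuts 3 G)
    {Y D : Finset V} {s a b c : V} (ha : a ∈ Y) (hb : b ∈ Y) (hc : c ∈ Y)
    (hYD : ∀ v ∈ Y, v ∉ D) (hs : s ∈ D) (haD : Attached G D a) (hbD : Attached G D b)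
    (hcD : Attached G D c) : HasSmallCuts 3 (addStar G Y s a b c) := by
  have hsY : s ∉ Y := fun h1 => hYD s h1 hs
  have key : ∀ y ∈ Y, SmallCut 3 (_root_.addStar G Y s a b c) s y := by
    intro y hy
    refine ⟨{s}, ({a, b, c} : Finset V).erase y, by simp, ?_, ?_, by simp, ?_, ?_⟩
    · simp; grind
    · simp; grind
    · intro p q
      rw [addStar_adj hsY ha hb hc]
      simp
      grind
    · rw [addStar_adj hsY ha hb hc, card_erase_eq_ite]
      have h3 : #({a, b, c} : Finset V) ≤ 3 := card_le_three
      have h4 : 0 < #({a, b, c} : Finset V) := card_pos.2 ⟨a, by simp⟩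
      simp only [mem_insert, mem_singleton]
      grind
  refine hasSmallCuts_of_support (X := insert s Y) (fun p q hpq => ?_) fun x hx y hy hxy => ?_
  · rw [addStar_adj hsY ha hb hc] at hpq
    grind
  by_cases hxs : x = s
  · exact hxs ▸ key y ((mem_insert.1 hy).resolve_left (hxs ▸ hxy.symm))
  replace hx := (mem_insert.1 hx).resolve_left hxs
  by_cases hys : y = s
  · exact hys ▸ (key x hx).symm
  replace hy := (mem_insert.1 hy).resolve_left hys
  have hadj : (_root_.addStar G Y s a b c).Adj x y ↔ G.Adj x y := by
    rw [addStar_adj hsY ha hb hc]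
    tauto
  obtain ⟨A, T, hxA, hxT, hyA, hyT, hE, hk⟩ := h x y hxy
  by_cases hTD : ∀ t ∈ T, t ∉ D
  · rcases same_side hE (hYD x hx) (hYD y hy) ⟨s, hs⟩ hTD with h1 | h1
    · have := h1 a haD
      have := h1 b hbD
      have := h1 c hcD
      refine ⟨insert s A, T, by simp [hxA], hxT, by simp [hyA, hys], hyT, ?_, by simpa [hadj]⟩
      intro p q
      have := hE p q
      rw [addStar_adj hsY ha hb hc]
      simp only [mem_insert]
      grind
    · have := h1 a haD
      have := h1 b hbD
      have := h1 c hcD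
      refine ⟨A.erase s, T, by simp [hxA, hxs], hxT, by simp [hyA], hyT, ?_, by simpa [hadj]⟩
      intro p q
      have := hE p q
      rw [addStar_adj hsY ha hb hc]
      simp only [mem_erase]
      grind
  · push Not at hTD
    obtain ⟨t, ht, htD⟩ := hTD
    have hlt : #(T ∩ Y) + 1 ≤ #T := card_lt_card ⟨inter_subset_left, fun h1 =>
      hYD t (mem_inter.1 (h1 ht)).2 htD⟩
    refine ⟨A, insert s (T ∩ Y), hxA, by simp [hxT, hxs], hyA, by simp [hyT, hys], ?_, ?_⟩
    · intro p q
      have := hE p q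
      rw [addStar_adj hsY ha hb hc]
      simp only [mem_insert, mem_inter]
      grind
    · have := card_insert_le s (T ∩ Y)
      simp only [hadj]
      omega

/-- `G[Y]` together with the path `a b c`. -/
def addPath (G : SimpleGraph V) (Y : Finset V) (a b c : V) : SimpleGraph V :=
  addEdge (addEdge (restrictTo G Y) a b) b c

omit [Fintype V] in
lemma addPath_adj {G : SimpleGraph V} {Y : Finset V} {a b c : V} (hab : a ≠ b) (hbc : b ≠ c)
    {x y : V} : (addPath G Y a b c).Adj x y ↔ G.Adj x y ∧ x ∈ Y ∧ y ∈ Y ∨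
      x = b ∧ (y = a ∨ y = c) ∨ y = b ∧ (x = a ∨ x = c) := by
  simp only [addPath, addEdge_adj, restrictTo_adj]
  grind

lemma arcs_addPath {G : SimpleGraph V} {Y : Finset V} {a b c : V} (hab : a ≠ b) (hbc : b ≠ c)
    (hac : a ≠ c) (hab' : ¬ G.Adj a b) (hbc' : ¬ G.Adj b c) :
    arcs (addPath G Y a b c) = arcs (restrictTo G Y) + 4 := by
  rw [addPath, arcs_addEdge, arcs_addEdge]
  all_goals
    try simp only [addEdge_adj, restrictTo_adj]
    grind

lemma HasSmallCuts.addPath {G : SimpleGraph V} {X A B S : Finset V} {a b c : V}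
    (h : HasSmallCuts 3 G) (hN : NoSep 2 G X) (hX : ∀ u v, G.Adj u v → u ∈ X)
    (hs : Separation G X A B S) (hS : S = {a, b, c}) (hab : a ≠ b) (hac : a ≠ c) (hbc : b ≠ c)
    (hab' : ¬ G.Adj a b) (hbc' : ¬ G.Adj b c) (hb : 2 ≤ degIn G B b) :
    HasSmallCuts 3 (addPath G (A ∪ S) a b c) := by
  have hcard : #S ≤ 3 := hS ▸ card_le_three
  have haS : a ∈ S := by simp [hS]
  have hbS : b ∈ S := by simp [hS]
  have hcS : c ∈ S := by simp [hS]
  have hYB : ∀ v ∈ A ∪ S, v ∉ B := by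
    intro v hv hvB
    rcases mem_union.1 hv with hv | hv
    · exact hs.disjAB v hv hvB
    · exact hs.disjBS v hvB hv
  have haB := hN.attached_of_separation hX hs hcard haS
  have hbB := hN.attached_of_separation hX hs hcard hbS
  have hcB := hN.attached_of_separation hX hs hcard hcS
  have hba' : ¬ G.Adj b a := fun h => hab' h.symm
  have hcb' : ¬ G.Adj c b := fun h => hbc' h.symm
  have key : ∀ q ∈ A ∪ S, b ≠ q → SmallCut 3 (_root_.addPath G (A ∪ S) a b c) b q := by
    intro q hq hbq
    obtain ⟨P, T, hbP, hbT, hqP, hqT, hE, hk⟩ := h b q hbq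
    by_cases hTB : ∀ t ∈ T, t ∉ B
    · have hs := (same_side hE (hYB b (by simp [hbS])) (hYB q hq) hs.right hTB).imp
        (fun h => And.intro (h a haB) (And.intro (h b hbB) (h c hcB)))
        (fun h => And.intro (h a haB) (And.intro (h b hbB) (h c hcB)))
      refine ⟨P, T, hbP, hbT, hqP, hqT, ?_, ?_⟩
      · intro v w
        have := hE v w
        rw [addPath_adj hab hbc]
        grind
      · rw [addPath_adj hab hbc]
        grind
    push Not at hTB
    obtain ⟨t, ht, htB⟩ := hTB
    by_cases hT2 : #(T ∩ (A ∪ S)) + 2 ≤ #T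
    · refine ⟨P, T ∩ (A ∪ S) ∪ ({a, c} : Finset V).erase q, hbP, ?_, hqP, ?_, ?_, ?_⟩
      · simp; grind
      · simp; grind
      · intro v w
        have := hE v w
        rw [addPath_adj hab hbc]
        simp only [mem_union, mem_inter, mem_erase, mem_insert, mem_singleton]
        grind
      · have h1 := card_union_le (T ∩ (A ∪ S)) (({a, c} : Finset V).erase q)
        have h2 : #({a, c} : Finset V) = 2 := card_pair hac
        have h3 := card_erase_eq_ite (s := ({a, c} : Finset V)) (a := q)
        rw [addPath_adj hab hbc]
        simp only [mem_insert, mem_singleton] at h3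
        grind
    have hlt : #(T ∩ (A ∪ S)) + 1 ≤ #T := card_lt_card ⟨inter_subset_left, fun h1 =>
      hYB t (mem_inter.1 (h1 ht)).2 htB⟩
    have htw : ∀ w ∈ T, w ∈ B → w = t := by
      intro w hw hwB
      by_contra hwt
      apply hT2
      have h1 : #(T ∩ (A ∪ S)) + #({t, w} : Finset V) ≤ #T := by
        rw [← card_union_of_disjoint]
        · refine card_le_card ?_
          intro v
          simp only [mem_union, mem_inter, mem_insert, mem_singleton]
          grind
        · rw [Finset.disjoint_left]
          intro v hv
          have := hYB v (mem_inter.1 hv).2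
          simp only [mem_insert, mem_singleton]
          grind
      rwa [card_pair (Ne.symm hwt)] at h1
    obtain ⟨z, hzB, hbz, hzt⟩ : ∃ z ∈ B, G.Adj b z ∧ z ≠ t := by
      obtain ⟨z, hz, hzt⟩ := exists_mem_ne (show 1 < #{w ∈ B | G.Adj b w} from hb) t
      simp only [mem_filter] at hz
      exact ⟨z, hz.1, hz.2, hzt⟩
    have hzq : z ≠ q := fun h1 => hYB q hq (h1 ▸ hzB)
    have hzT : z ∉ T := fun h1 => hzt (htw z h1 hzB)
    have hzP : z ∈ P := by
      by_contra hzP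
      exact hzq (hE b z hbP hbT hzP hzT hbz).2
    have hac' : (a ∈ P ∨ a ∈ T) ∨ (c ∈ P ∨ c ∈ T) := by
      by_contra! hc
      obtain ⟨v, hvX, w, hwX, hv, hvT, hw, hwT, hvw⟩ := hN (B ∩ P) {t, b} card_le_two
        ⟨z, (hs.mem z).2 (by tauto), by simp [hzB, hzP], by simp [hzt, hbz.ne']⟩
        ⟨a, (hs.mem a).2 (by tauto), by simp [hc.1.1],
          by
            have h1 : a ≠ t := fun h1 => hc.1.2 (h1 ▸ ht)
            simp [hab, h1]⟩
      have h1 := (hs.mem w).1 hwX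
      have h2 := hs.no_edge w
      have h3 := hvw.symm
      have h4 := hE v w
      have h5 := htw v
      have h6 := htw w
      have h7 := hs.disjBS v
      rw [hS] at h1 h7
      simp only [mem_inter, mem_insert, mem_singleton] at *
      grind
    by_cases hboth : (a ∈ P ∨ a ∈ T) ∧ (c ∈ P ∨ c ∈ T)
    · refine ⟨P, T ∩ (A ∪ S), hbP, by simp [hbT], hqP, by simp [hqT], ?_, ?_⟩
      · intro v w
        have := hE v w
        rw [addPath_adj hab hbc]
        simp only [mem_union, mem_inter]
        grind
      · rw [addPath_adj hab hbc]
        grind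
    · obtain ⟨r, hr, hr1, hr2⟩ : ∃ r, (r = a ∨ r = c) ∧ (r ∉ P ∧ r ∉ T) ∧
          ∀ r', (r' = a ∨ r' = c) → r' ≠ r → r' ∈ P ∨ r' ∈ T := by grind
      refine ⟨P, T ∩ (A ∪ S) ∪ ({r} : Finset V).erase q, hbP, ?_, hqP, ?_, ?_, ?_⟩
      · simp; grind
      · simp; grind
      · intro v w
        have := hE v w
        rw [addPath_adj hab hbc]
        simp only [mem_union, mem_inter, mem_erase, mem_singleton]
        grind
      · have h1 := card_union_le (T ∩ (A ∪ S)) (({r} : Finset V).erase q)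
        have h3 := card_erase_eq_ite (s := ({r} : Finset V)) (a := q)
        rw [addPath_adj hab hbc]
        simp only [mem_singleton, card_singleton] at h3
        grind
  refine hasSmallCuts_of_support (X := A ∪ S) (fun p q hpq => ?_) fun x hx y hy hxy => ?_
  · rw [addPath_adj hab hbc] at hpq
    grind
  by_cases hxb : x = b
  · exact hxb ▸ key y hy (hxb ▸ hxy)
  by_cases hyb : y = b
  · exact hyb ▸ (key x hx (hyb ▸ hxy.symm)).symm
  obtain ⟨P, T, hxP, hxT, hyP, hyT, hE, hk⟩ := h x y hxy
  have hadj : (_root_.addPath G (A ∪ S) a b c).Adj x y ↔ G.Adj x y := by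
    rw [addPath_adj hab hbc]
    tauto
  by_cases hTB : ∀ t ∈ T, t ∉ B
  · have hs := (same_side hE (hYB x hx) (hYB y hy) hs.right hTB).imp
      (fun h => And.intro (h a haB) (And.intro (h b hbB) (h c hcB)))
      (fun h => And.intro (h a haB) (And.intro (h b hbB) (h c hcB)))
    refine ⟨P, T, hxP, hxT, hyP, hyT, ?_, by simpa only [hadj]⟩
    intro v w
    have := hE v w
    rw [addPath_adj hab hbc]
    grind
  · push Not at hTB
    obtain ⟨t, ht, htB⟩ := hTB
    have hlt : #(T ∩ (A ∪ S)) + 1 ≤ #T := card_lt_card ⟨inter_subset_left, fun h1 =>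
      hYB t (mem_inter.1 (h1 ht)).2 htB⟩
    refine ⟨P, insert b (T ∩ (A ∪ S)), hxP, by simp [hxT, hxb], hyP, by simp [hyT, hyb], ?_, ?_⟩
    · intro v w
      have := hE v w
      rw [addPath_adj hab hbc]
      simp only [mem_insert, mem_inter]
      grind
    · have := card_insert_le b (T ∩ (A ∪ S))
      simp only [hadj]
      omega

/-- Some vertex of `X` is adjacent to all others, which have degree three. -/
def IsWheel (G : SimpleGraph V) (X : Finset V) : Prop :=
  ∃ h ∈ X, (∀ v ∈ X, v ≠ h → G.Adj h v) ∧ ∀ v ∈ X, v ≠ h → degIn G X v = 3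

lemma arcs_restrictTo_eq_sum (G : SimpleGraph V) (Y : Finset V) :
    arcs (restrictTo G Y) = ∑ v ∈ Y, degIn G Y v := by
  rw [arcs_eq_sum_of_support (G := restrictTo G Y) (X := Y) fun a b h => (restrictTo_adj.1 h).2.1]
  refine Finset.sum_congr rfl fun v hv => ?_
  unfold degIn
  congr 1
  ext w
  simp only [mem_filter, mem_univ, true_and, restrictTo_adj, hv]
  exact and_comm

lemma arcs_eq_sum_degIn {G : SimpleGraph V} {X : Finset V}
    (hX : ∀ a b, G.Adj a b → a ∈ X) : arcs G = ∑ v ∈ X, degIn G X v := by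
  rw [arcs_eq_sum_of_support hX]
  exact Finset.sum_congr rfl fun v _ => degIn_eq_of_support hX v

/-- No edge of a wheel is a bridge after deleting at most one vertex. -/
lemma IsWheel.not_bridge {G : SimpleGraph V} {X : Finset V} (hG : IsWheel G X)
    (hX : ∀ a b, G.Adj a b → a ∈ X) {C T : Finset V} (hT : #T ≤ 1) {u v : V} (huC : u ∈ C)
    (huT : u ∉ T) (hvC : v ∉ C) (hvT : v ∉ T) (huv : G.Adj u v)
    (hE : ∀ a b, a ∈ C → a ∉ T → b ∉ C → b ∉ T → G.Adj a b → a = u ∧ b = v) : False := by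
  obtain ⟨h, hhX, hadj, hdeg⟩ := hG
  have huX := hX _ _ huv
  have hvX := hX _ _ huv.symm
  by_cases hhT : h ∈ T
  · have hTh : ∀ t ∈ T, t = h := fun t ht => card_le_one.1 hT t ht h hhT
    have huh : u ≠ h := fun e => huT (e ▸ hhT)
    have hvh : v ≠ h := fun e => hvT (e ▸ hhT)
    set C' := {z ∈ X | z ∈ C ∧ z ≠ h} with hC'
    have hdeg' : ∀ z ∈ C', 3 = degIn G C' z + 1 + (if z = u then 1 else 0) := by
      intro z hz
      simp only [hC', mem_filter] at hz
      rw [← hdeg z hz.1 hz.2.2]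
      have hzh := (hadj z hz.1 hz.2.2).symm
      have hhC' : h ∉ {w ∈ C' | G.Adj z w} := by simp [hC']
      have hvC' : v ∉ insert h {w ∈ C' | G.Adj z w} := by simp [hC', hvC, hvh]
      unfold degIn
      split_ifs with hzu
      · rw [← card_insert_of_notMem hhC', ← card_insert_of_notMem hvC']
        congr 1
        ext w
        have := hE z w
        have := hTh w
        have := hTh z
        have := fun e : G.Adj z w => hX _ _ e.symm
        simp only [mem_filter, mem_insert, hC']
        grind
      · rw [← card_insert_of_notMem hhC']
        congr 1
        ext w
        have := hE z w
        have := hTh w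
        have := hTh z
        have := fun e : G.Adj z w => hX _ _ e.symm
        simp only [mem_filter, mem_insert, hC']
        grind
    have hsum := Finset.sum_congr (rfl : C' = C') hdeg'
    have huC' : u ∈ C' := by simp [hC', huX, huC, huh]
    rw [Finset.sum_add_distrib, Finset.sum_add_distrib, ← arcs_restrictTo_eq_sum,
      Finset.sum_ite_eq' C' u] at hsum
    simp only [huC', if_true, sum_const, smul_eq_mul] at hsum
    have := even_arcs (restrictTo G C')
    omega
  · by_cases hhC : h ∈ C
    · have hvh : v ≠ h := fun e => hvC (e ▸ hhC)
      have hhu : h = u := (hE h v hhC hhT hvC hvT (hadj v hvX hvh)).1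
      have h3 : degIn G X v ≤ #(insert u T) := by
        refine card_le_card fun w hw => ?_
        have := hE w v
        have := hE h w hhC hhT
        have := hadj w
        have := G.adj_comm v w
        have := G.loopless.irrefl v
        simp only [mem_filter, mem_insert] at hw ⊢
        grind
      have := card_insert_le u T
      have := hdeg v hvX hvh
      omega
    · have huh : u ≠ h := fun e => hhC (e ▸ huC)
      have hhv : h = v := (hE u h huC huT hhC hhT (hadj u huX huh).symm).2
      have h3 : degIn G X u ≤ #(insert v T) := by
        refine card_le_card fun w hw => ?_
        have := hE u w
        have := fun hw => hE w h hw
        have := hadj w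
        have := G.adj_comm h w
        have := G.loopless.irrefl u
        simp only [mem_filter, mem_insert] at hw ⊢
        grind
      have := card_insert_le v T
      have := hdeg u huX huh
      omega

lemma NoSep.restrictTo_addEdge {k : ℕ} {G : SimpleGraph V} {X A B : Finset V} {u v : V}
    (h : NoSep k G X) (hs : Separation G X A B {u, v}) (huv : u ≠ v) :
    NoSep k (addEdge (restrictTo G (A ∪ {u, v})) u v) (A ∪ {u, v}) := by
  intro C T hT hC hC'
  by_contra! hE
  have hk : #(T ∩ (A ∪ {u, v})) ≤ k := (card_le_card inter_subset_left).trans hT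
  obtain ⟨⟨s, hsS, hs1⟩, ⟨t, htS, ht1⟩⟩ := h.exists_divided hs hk hC hC'
    (fun a ha b hb h1 h2 h3 h4 h5 => hE a ha b hb h1 h2 h3 h4 (Or.inl ⟨h5, ha, hb⟩))
  refine hE s (mem_union_right _ hsS) t (mem_union_right _ htS) hs1.1 hs1.2 ht1.1 ht1.2 ?_
  rw [addEdge_adj]
  simp only [mem_insert, mem_singleton] at hsS htS
  grind

lemma Attached.exists_crossing {G : SimpleGraph V} {A C T : Finset V} {s t : V}
    (hs : Attached G A s) (ht : Attached G A t) (hA : A.Nonempty) (hT : ∀ v ∈ A, v ∉ T)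
    (hsC : s ∈ C ∧ s ∉ T) (htC : t ∉ C ∧ t ∉ T) :
    ∃ a b, (a ∈ A ∨ a = s) ∧ (b ∈ A ∨ b = t) ∧
      a ∈ C ∧ a ∉ T ∧ b ∉ C ∧ b ∉ T ∧ G.Adj a b := by
  by_contra! hE
  by_cases hZ : ∃ d ∈ A, d ∈ C
  · obtain ⟨d, hd, hdC⟩ := hZ
    obtain ⟨z, hz, hzt⟩ := ht (A.filter (· ∈ C)) (filter_subset _ _) ⟨d, by simp [hd, hdC]⟩ (by
      intro z hz d hd hdz hzd
      simp only [mem_filter, not_and] at hz hdz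
      exact hE z d (Or.inl hz.1) (Or.inl hd) hz.2 (hT z hz.1) (hdz hd) (hT d hd) hzd)
    simp only [mem_filter] at hz
    exact hE z t (Or.inl hz.1) (Or.inr rfl) hz.2 (hT z hz.1) htC.1 htC.2 hzt
  · push Not at hZ
    obtain ⟨z, hz, hzs⟩ := hs A subset_rfl hA (by intro _ _ d hd hd'; exact absurd hd hd')
    exact hE s z (Or.inr rfl) (Or.inl hz) hsC.1 hsC.2 (hZ z hz) (hT z hz) hzs.symm

lemma NoSep.addStar {G : SimpleGraph V} {X A B S : Finset V} {s a b c : V}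
    (h : NoSep 2 G X) (hX : ∀ a b, G.Adj a b → a ∈ X) (hs : Separation G X A B S)
    (hS : S = {a, b, c}) (hab : a ≠ b) (hsB : s ∈ B) :
    NoSep 1 (addStar G (A ∪ S) s a b c) (insert s (A ∪ S)) := by
  have hcard : #S ≤ 3 := hS ▸ card_le_three
  have hat := fun t ht => h.attached_of_separation hX hs.symm hcard (s := t) ht
  have haS : a ∈ S := by simp [hS]
  have hbS : b ∈ S := by simp [hS]
  have hcS : c ∈ S := by simp [hS]
  have hsS := hs.disjBS s hsB
  have hsA := fun h1 => hs.disjAB s h1 hsB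
  have hsY : s ∉ A ∪ S := by simp; tauto
  intro C T hT ⟨v, hv, hvC, hvT⟩ ⟨w, hw, hwC, hwT⟩
  by_contra! hE
  have hT1 := fun x hx y hy => card_le_one.1 hT x hx y hy
  simp only [addStar_adj hsY (mem_union_right A haS) (mem_union_right A hbS)
    (mem_union_right A hcS)] at hE
  have hEs := fun z => hE s (by simp) z
  have hEs' := fun z hz => hE z hz s (by simp)
  have key : (∃ v ∈ A ∪ S, v ∈ C ∧ v ∉ T) ∧ ∃ v ∈ A ∪ S, v ∉ C ∧ v ∉ T := by
    have h1 : ∃ x ∈ S, x ∉ T ∧ (x = a ∨ x = b ∨ x = c) := by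
      by_cases haT : a ∈ T
      · exact ⟨b, hbS, fun hbT => hab (hT1 a haT b hbT), by simp⟩
      · exact ⟨a, haS, haT, by simp⟩
    obtain ⟨x, hxS, hxT, hx⟩ := h1
    have hx1 := hEs x (by simp [hxS])
    have hx2 := hEs' x (by simp [hxS])
    constructor
    · by_cases hvs : v = s
      · refine ⟨x, by simp [hxS], ?_, hxT⟩
        grind
      · exact ⟨v, by grind, hvC, hvT⟩
    · by_cases hws : w = s
      · refine ⟨x, by simp [hxS], ?_, hxT⟩
        grind
      · exact ⟨w, by grind, hwC, hwT⟩
  obtain ⟨⟨p, hpS, hp⟩, ⟨q, hqS, hq⟩⟩ := h.exists_divided hs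
    ((card_le_card inter_subset_left).trans (hT.trans one_le_two)) key.1 key.2
    (fun a ha b hb h1 h2 h3 h4 h5 => hE a (mem_insert_of_mem ha) b (mem_insert_of_mem hb) h1 h2 h3
      h4 (Or.inl ⟨h5, ha, hb⟩))
  by_cases hsT : s ∈ T
  · obtain ⟨x, y, hx, hy, h1, h2, h3, h4, h5⟩ := (hat p hpS).exists_crossing (hat q hqS) hs.left
      (fun v hv hvT => hsA (hT1 s hsT v hvT ▸ hv)) hp hq
    have hxY : x ∈ A ∪ S := hx.elim (mem_union_left _) fun e => mem_union_right _ (e ▸ hpS)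
    have hyY : y ∈ A ∪ S := hy.elim (mem_union_left _) fun e => mem_union_right _ (e ▸ hqS)
    exact hE x (mem_insert_of_mem hxY) y (mem_insert_of_mem hyY) h1 h2 h3 h4
      (Or.inl ⟨h5, hxY, hyY⟩)
  · have h1 := hEs q (by simp [hqS])
    have h2 := hEs' p (by simp [hpS])
    rw [hS] at hpS hqS
    simp only [mem_insert, mem_singleton] at hpS hqS
    grind

lemma NoSep.addPath {G : SimpleGraph V} {X A B S : Finset V} {a b c : V}
    (h : NoSep 2 G X) (hX : ∀ a b, G.Adj a b → a ∈ X) (hs : Separation G X A B S)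
    (hS : S = {a, b, c}) (hab : a ≠ b) (hbc : b ≠ c) :
    NoSep 1 (addPath G (A ∪ S) a b c) (A ∪ S) := by
  have hcard : #S ≤ 3 := hS ▸ card_le_three
  have hat := fun t ht => h.attached_of_separation hX hs.symm hcard (s := t) ht
  have hbS : b ∈ S := by simp [hS]
  intro C T hT hC hC'
  by_contra! hE
  have hT1 := fun x hx y hy => card_le_one.1 hT x hx y hy
  simp only [addPath_adj hab hbc] at hE
  obtain ⟨⟨p, hpS, hp⟩, ⟨q, hqS, hq⟩⟩ := h.exists_divided hs
    ((card_le_card inter_subset_left).trans (hT.trans one_le_two)) hC hC'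
    (fun a ha b hb h1 h2 h3 h4 h5 => hE a ha b hb h1 h2 h3 h4 (Or.inl ⟨h5, ha, hb⟩))
  by_cases hbT : b ∈ T
  · obtain ⟨x, y, hx, hy, h1, h2, h3, h4, h5⟩ := (hat p hpS).exists_crossing (hat q hqS) hs.left
      (fun v hv hvT => hs.disjAS v hv (hT1 b hbT v hvT ▸ hbS)) hp hq
    have hxY : x ∈ A ∪ S := hx.elim (mem_union_left _) fun e => mem_union_right _ (e ▸ hpS)
    have hyY : y ∈ A ∪ S := hy.elim (mem_union_left _) fun e => mem_union_right _ (e ▸ hqS)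
    exact hE x hxY y hyY h1 h2 h3 h4 (Or.inl ⟨h5, hxY, hyY⟩)
  · have h1 := hE b (by simp [hbS]) q (by simp [hqS])
    have h2 := hE p (by simp [hpS]) b (by simp [hbS])
    rw [hS] at hpS hqS
    simp only [mem_insert, mem_singleton] at hpS hqS
    grind

/-- The extremal statement for graphs with cuts of size three. -/
def TightBound (G : SimpleGraph V) (X : Finset V) : Prop :=
  arcs G + 4 ≤ 4 * #X ∧ (arcs G + 4 = 4 * #X → NoSep 1 G X → IsWheel G X)

/-- The extremal statement holds for all vertex sets of size less than `n`. -/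
def BoundBelow (V : Type*) [Fintype V] (n : ℕ) : Prop :=
  ∀ (H : SimpleGraph V) (Y : Finset V), #Y < n → Y.Nonempty → (∀ a b, H.Adj a b → a ∈ Y) →
    HasSmallCuts 3 H → TightBound H Y

lemma Separation.arcs_add {G : SimpleGraph V} {X A B S : Finset V} (hs : Separation G X A B S)
    (hX : ∀ a b, G.Adj a b → a ∈ X) :
    arcs (restrictTo G (A ∪ S)) + arcs (restrictTo G (B ∪ S)) = arcs G + arcs (restrictTo G S) :=
  arcs_restrictTo_add (fun a b hab => (hs.mem a).1 (hX a b hab)) hs.disjAB hs.no_edge hs.disjAS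

lemma arcs_restrictTo_pair {G : SimpleGraph V} {u v : V} (huv : u ≠ v) :
    arcs (restrictTo G {u, v}) = 2 * (if G.Adj u v then 1 else 0) := by
  rw [arcs_restrictTo_insert (by simp [huv]), arcs_restrictTo_singleton]
  simp only [degIn, Finset.filter_singleton]
  split_ifs <;> simp_all

lemma BoundBelow.arcs_restrictTo_le {n : ℕ} {G : SimpleGraph V} {Y : Finset V} (IH : BoundBelow V n)
    (h : HasSmallCuts 3 G) (hY : #Y < n) (hY' : Y.Nonempty) :
    arcs (restrictTo G Y) + 4 ≤ 4 * #Y :=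
  (IH (restrictTo G Y) Y hY hY' (fun _ _ hab => (restrictTo_adj.1 hab).2.1)
    (h.mono fun _ _ hab => (restrictTo_adj.1 hab).1)).1

lemma BoundBelow.arcs_le_of_separation {G : SimpleGraph V} {X A B S : Finset V}
    (IH : BoundBelow V #X) (h : HasSmallCuts 3 G) (hX : ∀ a b, G.Adj a b → a ∈ X)
    (hs : Separation G X A B S) (hS : #S ≤ 1) : arcs G + 4 ≤ 4 * #X := by
  have h1 := hs.card
  have h2 := hs.card_left_union
  have h3 := hs.symm.card_left_union
  have hA := hs.left.card_pos
  have hB := hs.right.card_pos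
  have h4 := IH.arcs_restrictTo_le h (Y := A ∪ S) (by omega) (hs.left.mono subset_union_left)
  have h5 := IH.arcs_restrictTo_le h (Y := B ∪ S) (by omega) (hs.right.mono subset_union_left)
  have := hs.arcs_add hX
  omega

lemma arcs_addEdge_restrictTo {G : SimpleGraph V} {Y : Finset V} {u v : V} (huv : u ≠ v)
    (hu : u ∈ Y) (hv : v ∈ Y) : arcs (addEdge (restrictTo G Y) u v) =
      arcs (restrictTo G Y) + 2 * (if G.Adj u v then 0 else 1) := by
  split_ifs with huv'
  · rw [addEdge_eq_self (restrictTo_adj.2 ⟨huv', hu, hv⟩), mul_zero, add_zero]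
  · rw [arcs_addEdge huv fun h => huv' (restrictTo_adj.1 h).1]

lemma BoundBelow.side_le {G : SimpleGraph V} {X A B : Finset V} {u v : V}
    (IH : BoundBelow V #X) (h : HasSmallCuts 3 G) (hX : ∀ a b, G.Adj a b → a ∈ X)
    (hN : NoSep 1 G X) (hs : Separation G X A B {u, v}) (huv : u ≠ v) :
    arcs (restrictTo G (A ∪ {u, v})) + 2 * (if G.Adj u v then 0 else 1) ≤ 4 * #A + 4 ∧
    ∀ C T : Finset V, u ∈ C → u ∉ T → v ∉ C → v ∉ T →
      (∀ a b, a ∈ C → a ∉ T → b ∉ C → b ∉ T → G.Adj a b → a = u ∧ b = v) → #(T ∩ A) ≤ 1 →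
      arcs (restrictTo G (A ∪ {u, v})) + 2 * (if G.Adj u v then 0 else 1) ≤ 4 * #A + 2 := by
  have hcard : #({u, v} : Finset V) = 2 := card_pair huv
  have h1 := hs.card
  have h2 := hs.card_left_union
  have hB := hs.right.card_pos
  have hu : u ∈ A ∪ {u, v} := by simp
  have hv : v ∈ A ∪ {u, v} := by simp
  have hat := fun t ht => hN.attached_of_separation hX hs hcard.le (s := t) ht
  have hsupp : ∀ a b, (addEdge (restrictTo G (A ∪ {u, v})) u v).Adj a b → a ∈ A ∪ {u, v} := by
    intro a b hab
    rw [addEdge_adj, restrictTo_adj] at hab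
    grind
  have hI := IH (addEdge (restrictTo G (A ∪ {u, v})) u v) (A ∪ {u, v}) (by omega) ⟨u, hu⟩ hsupp
    (h.restrictTo_addEdge (D := B) huv hu hv (fun w hw hwB => by
      have := hs.disjAB w
      have := hs.disjBS w hwB
      grind) hs.right (hat u (by simp)) (hat v (by simp)))
  have hN' := hN.restrictTo_addEdge hs huv
  rw [TightBound, ← arcs_addEdge_restrictTo huv hu hv] at *
  refine ⟨by omega, fun C T huC huT hvC hvT hE hT => ?_⟩
  by_contra! hlt
  have heven := even_arcs (addEdge (restrictTo G (A ∪ {u, v})) u v)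
  refine (hI.2 (by omega) hN').not_bridge hsupp (C := C) (T := T ∩ A) hT huC
    (by simp [huT]) hvC (by simp [hvT]) (addEdge_adj.2 (Or.inr ⟨huv, by simp⟩)) ?_
  intro a b ha haT hb hbT hab
  rw [addEdge_adj, restrictTo_adj] at hab
  have := hE a b ha
  simp only [mem_inter, mem_union, mem_insert, mem_singleton] at hab haT hbT
  grind

omit [Fintype V] in
lemma Separation.card_inter_add_le {G : SimpleGraph V} {X A B S : Finset V}
    (hs : Separation G X A B S) (T : Finset V) : #(T ∩ A) + #(T ∩ B) ≤ #T := by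
  rw [← card_union_of_disjoint]
  · exact card_le_card (union_subset inter_subset_left inter_subset_left)
  · rw [Finset.disjoint_left]
    intro w hw hw'
    exact hs.disjAB w (mem_inter.1 hw).2 (mem_inter.1 hw').2

omit [Fintype V] in
lemma NoSep.one_le_card_inter {G : SimpleGraph V} {X A B C T : Finset V} {u v : V}
    (hN : NoSep 1 G X) (hX : ∀ a b, G.Adj a b → a ∈ X) (hs : Separation G X A B {u, v})
    (huv : u ≠ v) (huC : u ∈ C) (huT : u ∉ T) (hvC : v ∉ C) (hvT : v ∉ T)
    (hE : ∀ a b, a ∈ C → a ∉ T → b ∉ C → b ∉ T → G.Adj a b → a = u ∧ b = v) :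
    1 ≤ #(T ∩ B) := by
  by_contra! h0
  have h0 : T ∩ B = ∅ := by rw [← card_eq_zero]; omega
  have hat := fun t ht => hN.attached_of_separation hX hs (card_pair huv).le (s := t) ht
  have huB := hs.disjBS u
  have hvB := hs.disjBS v
  rcases same_side hE (D := B) (fun h => huB h (by simp)) (fun h => hvB h (by simp)) hs.right
    (fun t ht htB => by simpa [h0] using mem_inter.2 ⟨ht, htB⟩) with h3 | h3
  · have := h3 v (hat v (by simp)); tauto
  · have := h3 u (hat u (by simp)); tauto

lemma BoundBelow.arcs_le_of_pair {G : SimpleGraph V} {X A B : Finset V} {u v : V}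
    (IH : BoundBelow V #X) (h : HasSmallCuts 3 G) (hX : ∀ a b, G.Adj a b → a ∈ X)
    (hN : NoSep 1 G X) (hs : Separation G X A B {u, v}) (huv : u ≠ v) :
    arcs G + 6 ≤ 4 * #X := by
  have hcard : #({u, v} : Finset V) = 2 := card_pair huv
  have h1 := hs.card
  obtain ⟨hA, hA'⟩ := IH.side_le h hX hN hs huv
  obtain ⟨hB, hB'⟩ := IH.side_le h hX hN hs.symm huv
  have hadd := hs.arcs_add hX
  rw [arcs_restrictTo_pair huv] at hadd
  obtain ⟨C, T, huC, huT, hvC, hvT, hE, hk⟩ := h u v huv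
  have hdisj := hs.card_inter_add_le T
  have hA'' := hA' C T huC huT hvC hvT hE
  have hB'' := hB' C T huC huT hvC hvT hE
  have hmA := hN.one_le_card_inter hX hs.symm huv huC huT hvC hvT hE
  have hmB := hN.one_le_card_inter hX hs huv huC huT hvC hvT hE
  by_cases hadj : G.Adj u v
  · simp only [hadj, if_true] at *
    have := hA'' (by omega)
    have := hB'' (by omega)
    omega
  · simp only [hadj, if_false] at *
    by_cases h5 : #(T ∩ A) ≤ 1
    · have := hA'' h5; omega
    · have := hB'' (by omega); omega

omit [Fintype V] in
lemma NoSep.le_degIn {k : ℕ} {G : SimpleGraph V} {X : Finset V} (h : NoSep k G X) {v : V}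
    (hv : v ∈ X) (hX : k + 2 ≤ #X) : k + 1 ≤ degIn G X v := by
  by_contra! hlt
  have hins := card_insert_le v {w ∈ X | G.Adj v w}
  unfold degIn at hlt
  obtain ⟨b, hb, hb'⟩ := exists_mem_notMem_of_card_lt_card
    (s := insert v {w ∈ X | G.Adj v w}) (t := X) (by omega)
  simp only [mem_insert, mem_filter, not_or, not_and] at hb'
  obtain ⟨p, hpX, q, hqX, hp, hpT, hq, hqT, hpq⟩ := h {v} {w ∈ X | G.Adj v w} (by omega)
    ⟨v, hv, by simp⟩ ⟨b, hb, by simp [hb'.1], by simp [hb'.2 hb]⟩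
  rw [mem_singleton] at hp
  simp only [mem_filter, not_and] at hqT
  exact hqT hqX (hp ▸ hpq)

omit [Fintype V] in
lemma adj_of_degIn {G : SimpleGraph V} {X : Finset V} {v : V} (hv : v ∈ X)
    (h : #X ≤ degIn G X v + 1) : ∀ w ∈ X, w ≠ v → G.Adj v w := by
  have hsub : {w ∈ X | G.Adj v w} ⊆ X.erase v := by
    intro w hw
    simp only [mem_filter] at hw
    exact mem_erase.2 ⟨hw.2.ne', hw.1⟩
  have heq := eq_of_subset_of_card_le hsub (by rw [card_erase_of_mem hv]; unfold degIn at h; omega)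
  intro w hw hwv
  have : w ∈ {w ∈ X | G.Adj v w} := heq ▸ mem_erase.2 ⟨hwv, hw⟩
  exact (mem_filter.1 this).2

omit [Fintype V] in
lemma degIn_of_adj {G : SimpleGraph V} {X : Finset V} {v : V} (hv : v ∈ X)
    (h : ∀ w ∈ X, w ≠ v → G.Adj v w) : degIn G X v + 1 = #X := by
  have h1 := degIn_lt_card (G := G) hv
  have h2 : X.erase v ⊆ {w ∈ X | G.Adj v w} := by
    intro w hw
    rw [mem_erase] at hw
    exact mem_filter.2 ⟨hw.2, h w hw.2 hw.1⟩
  have h3 := card_le_card h2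
  rw [card_erase_of_mem hv] at h3
  unfold degIn at *
  omega

lemma isWheel_of_degIn_le {G : SimpleGraph V} {X : Finset V} (hX : ∀ a b, G.Adj a b → a ∈ X)
    (hG : arcs G + 4 = 4 * #X) {v : V} (hv : v ∈ X) (h : ∀ w ∈ X, w ≠ v → degIn G X w ≤ 3) :
    IsWheel G X := by
  have hsum := arcs_eq_sum_degIn hX
  rw [← add_sum_erase X _ hv] at hsum
  have h1 := degIn_lt_card (G := G) hv
  have h2 : ∀ w ∈ X.erase v, degIn G X w ≤ 3 := fun w hw =>
    h w (mem_of_mem_erase hw) (ne_of_mem_erase hw)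
  have h3 := sum_le_sum h2
  have h4 := card_erase_of_mem hv
  rw [sum_const, smul_eq_mul] at h3
  have h5 := (sum_eq_sum_iff_of_le h2).1 (by rw [sum_const, smul_eq_mul]; omega)
  exact ⟨v, hv, fun w hw hwv => adj_of_degIn hv (by omega) w hw hwv,
    fun w hw hwv => h5 w (mem_erase.2 ⟨hwv, hw⟩)⟩

lemma isWheel_of_adj {G : SimpleGraph V} {X : Finset V} (hX : ∀ a b, G.Adj a b → a ∈ X)
    (hG : arcs G + 4 = 4 * #X) {v : V} (hv : v ∈ X) (hadj : ∀ w ∈ X, w ≠ v → G.Adj v w)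
    (h : ∀ w ∈ X, 3 ≤ degIn G X w) : IsWheel G X := by
  have hsum := arcs_eq_sum_degIn hX
  rw [← add_sum_erase X _ hv] at hsum
  have h1 := degIn_of_adj hv hadj
  have h2 : ∀ w ∈ X.erase v, 3 ≤ degIn G X w := fun w hw => h w (mem_of_mem_erase hw)
  have h4 := card_erase_of_mem hv
  have h5 := (sum_eq_sum_iff_of_le h2).1 (by rw [sum_const, smul_eq_mul]; omega)
  exact ⟨v, hv, hadj, fun w hw hwv => (h5 w (mem_erase.2 ⟨hwv, hw⟩)).symm⟩

omit [Fintype V] in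
lemma card_nbrs_le_of_one_edge {G : SimpleGraph V} {X A B T : Finset V} {x y : V}
    (hmem : ∀ v, v ∈ X ↔ v ∈ A ∨ v ∈ B ∨ v ∈ T)
    (hE : ∀ a ∈ A, ∀ b ∈ B, G.Adj a b → a = x ∧ b = y) {v : V} (hv : v ∈ A) (T' : Finset V)
    (hT' : ∀ t ∈ T, G.Adj v t → t ∈ T') :
    degIn G X v + 1 ≤ #A + #T' + (if v = x then 1 else 0) := by
  have h1 : {w ∈ X | G.Adj v w} ⊆ A.erase v ∪ T' ∪ (if v = x then {y} else ∅) := by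
    intro w hw
    have := hmem w
    have := hE v hv w
    have := hT' w
    have := G.loopless.irrefl v
    simp only [mem_filter] at hw
    by_cases hvx : v = x
    · simp only [hvx, if_true, mem_union, mem_erase, mem_singleton]
      grind
    · simp only [hvx, if_false, mem_union, mem_erase, notMem_empty]
      grind
  have h2 := card_le_card h1
  have h3 := card_union_le (A.erase v ∪ T') (if v = x then {y} else ∅)
  have h4 := card_union_le (A.erase v) T'
  have h5 := card_erase_of_mem hv
  have h6 : 0 < #A := card_pos.2 ⟨v, hv⟩
  unfold degIn
  split_ifs at * <;> simp only [card_singleton, card_empty] at * <;> omega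

omit [Fintype V] in
lemma NoSep.exists_separation_or {G : SimpleGraph V} {X A B T : Finset V} {x y : V}
    (hN : NoSep 2 G X) (hdeg : ∀ v ∈ X, 3 ≤ degIn G X v)
    (hmem : ∀ v, v ∈ X ↔ v ∈ A ∨ v ∈ B ∨ v ∈ T) (hAB : ∀ v ∈ A, v ∉ B) (hAT : ∀ v ∈ A, v ∉ T)
    (hBT : ∀ v ∈ B, v ∉ T) (hE : ∀ a ∈ A, ∀ b ∈ B, G.Adj a b → a = x ∧ b = y) (hx : x ∈ A)
    (hT : #T ≤ 2) (hB : 2 ≤ #B) (h4 : 4 ≤ degIn G X x) :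
    (∃ A' B' S, Separation G X A' B' S ∧ #S = 3 ∧ 2 ≤ #A' ∧ 2 ≤ #B') ∨
      #A = 2 ∧ #T = 2 ∧ ∀ v ∈ A, ∀ t ∈ T, G.Adj v t := by
  have h1 := card_nbrs_le_of_one_edge hmem hE hx T (fun t ht _ => ht)
  simp only [if_true] at h1
  by_cases hA : 3 ≤ #A
  · left
    have h2 := card_erase_of_mem hx
    have hs : Separation G X (A.erase x) B (insert x T) := by
      refine ⟨fun v => ?_, fun v hv => hAB v (mem_of_mem_erase hv), fun v hv => ?_, fun v hv => ?_,
        fun a ha b hb hab => ?_, card_pos.1 (by omega), card_pos.1 (by omega)⟩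
      · have := hmem v
        simp only [mem_erase, mem_insert]
        grind
      · have := hAT v
        simp only [mem_erase, mem_insert] at hv ⊢
        grind
      · have := hAB v
        have := hBT v hv
        simp only [mem_insert]
        grind
      · have := hE a (mem_of_mem_erase ha) b hb hab
        exact ne_of_mem_erase ha this.1
    have h3 := hN.lt_card hs
    have h5 := card_insert_le x T
    exact ⟨_, _, _, hs, by omega, by omega, hB⟩
  · right
    refine ⟨by omega, by omega, fun v hv t ht => ?_⟩
    by_contra hvt
    have h2 := card_nbrs_le_of_one_edge hmem hE hv (T.erase t)
      (fun t' ht' h => mem_erase.2 ⟨fun e => hvt (e ▸ h), ht'⟩)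
    have h3 := card_erase_of_mem ht
    have h5 := hdeg v ((hmem v).2 (Or.inl hv))
    split_ifs at h2 with hvx
    · rw [hvx] at h2; omega
    · omega

lemma HasSmallCuts.exists_separation {G : SimpleGraph V} {X : Finset V} (h : HasSmallCuts 3 G)
    (hN : NoSep 2 G X) {x y : V} (hx : x ∈ X)
    (hy : y ∈ X) (hxy : x ≠ y) (hxd : 4 ≤ degIn G X x) (hyd : 4 ≤ degIn G X y) :
    ∃ A B S, Separation G X A B S ∧ #S = 3 ∧ 2 ≤ #A ∧ 2 ≤ #B := by
  have hn := degIn_lt_card (G := G) hx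
  have hdeg : ∀ v ∈ X, 3 ≤ degIn G X v := fun v hv => hN.le_degIn hv (by omega)
  obtain ⟨C, T₀, hxC, hxT, hyC, hyT, hE, hk⟩ := h x y hxy
  set A := {v ∈ X | v ∈ C ∧ v ∉ T₀} with hA
  set B := {v ∈ X | v ∉ C ∧ v ∉ T₀} with hB
  set T := {v ∈ X | v ∈ T₀} with hT
  have hTT : #T ≤ #T₀ := card_le_card fun v hv => (mem_filter.1 hv).2
  have hxA : x ∈ A := by simp [*]
  have hyB : y ∈ B := by simp [*]
  have hmem : ∀ v, v ∈ X ↔ v ∈ A ∨ v ∈ B ∨ v ∈ T := by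
    intro v; simp only [hA, hB, hT, mem_filter]; tauto
  have hAB : ∀ v ∈ A, v ∉ B := by intro v; simp only [hA, hB, mem_filter]; tauto
  have hAT : ∀ v ∈ A, v ∉ T := by intro v; simp only [hA, hT, mem_filter]; tauto
  have hBT : ∀ v ∈ B, v ∉ T := by intro v; simp only [hB, hT, mem_filter]; tauto
  have hE' : ∀ a ∈ A, ∀ b ∈ B, G.Adj a b → a = x ∧ b = y := by
    intro a ha b hb
    simp only [hA, hB, mem_filter] at ha hb
    exact hE a b ha.2.1 ha.2.2 hb.2.1 hb.2.2
  have hmem' : ∀ v, v ∈ X ↔ v ∈ B ∨ v ∈ A ∨ v ∈ T := fun v => by rw [hmem]; tauto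
  have hE'' : ∀ b ∈ B, ∀ a ∈ A, G.Adj b a → b = y ∧ a = x := fun b hb a ha hab =>
    (hE' a ha b hb hab.symm).symm
  have hcA := card_nbrs_le_of_one_edge hmem hE' hxA T (fun t ht _ => ht)
  have hcB := card_nbrs_le_of_one_edge hmem' hE'' hyB T (fun t ht _ => ht)
  simp only [if_true] at hcA hcB
  by_cases hadj : G.Adj x y
  · simp only [hadj, if_true] at hk
    rcases hN.exists_separation_or hdeg hmem hAB hAT hBT hE' hxA (by omega) (by omega) hxd with
      h1 | ⟨hA2, hT2, hAadj⟩
    · exact h1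
    rcases hN.exists_separation_or hdeg hmem' (fun v hv hv' => hAB v hv' hv) hBT hAT hE'' hyB
      (by omega) (by omega) hyd with h1 | ⟨hB2, -, hBadj⟩
    · exact h1
    obtain ⟨t, u, htu, hTtu⟩ := card_eq_two.1 hT2
    have := h.card_common_le htu (A ∪ B) (fun v hv => by
      rcases mem_union.1 hv with hv | hv
      · exact ⟨hAadj v hv t (by simp [hTtu]), hAadj v hv u (by simp [hTtu])⟩
      · exact ⟨hBadj v hv t (by simp [hTtu]), hBadj v hv u (by simp [hTtu])⟩)
    rw [card_union_of_disjoint (Finset.disjoint_left.2 hAB)] at this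
    omega
  · simp only [hadj, if_false] at hk
    have hnoE : ∀ a ∈ A, ∀ b ∈ B, ¬ G.Adj a b := by
      intro a ha b hb hab
      obtain ⟨rfl, rfl⟩ := hE' a ha b hb hab
      exact hadj hab
    have hs : Separation G X A B T := ⟨hmem, hAB, hAT, hBT, hnoE, ⟨x, hxA⟩, ⟨y, hyB⟩⟩
    have h3 := hN.lt_card hs
    have h5 : degIn G X x + 1 ≤ #A + #T := by
      have := card_nbrs_le_of_one_edge (x := y) (y := y) hmem
        (fun a ha b hb hab => absurd hab (hnoE a ha b hb)) hxA T (fun t ht _ => ht)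
      rwa [if_neg hxy] at this
    have h6 : degIn G X y + 1 ≤ #B + #T := by
      have := card_nbrs_le_of_one_edge (x := x) (y := x) hmem'
        (fun a ha b hb hab => absurd hab.symm (hnoE b hb a ha)) hyB T (fun t ht _ => ht)
      rwa [if_neg hxy.symm] at this
    exact ⟨A, B, T, hs, by omega, by omega, by omega⟩

lemma BoundBelow.star_side {G : SimpleGraph V} {X A B S : Finset V} {a b c : V}
    (IH : BoundBelow V #X) (h : HasSmallCuts 3 G) (hX : ∀ a b, G.Adj a b → a ∈ X)
    (hN : NoSep 2 G X) (hs : Separation G X A B S) (hS : S = {a, b, c}) (hab : a ≠ b)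
    (hac : a ≠ c) (hbc : b ≠ c) (hB : 2 ≤ #B) :
    arcs (restrictTo G (A ∪ S)) ≤ 4 * #A + 6 ∧ (arcs (restrictTo G (A ∪ S)) = 4 * #A + 6 →
      ∃ p ∈ S, ∀ v ∈ A ∪ S, v ≠ p → G.Adj p v) := by
  have hcard : #S = 3 := hS ▸ card_eq_three.2 ⟨a, b, c, hab, hac, hbc, rfl⟩
  have hat := fun t ht => hN.attached_of_separation hX hs hcard.le (s := t) ht
  have haS : a ∈ S := by simp [hS]
  have hbS : b ∈ S := by simp [hS]
  have hcS : c ∈ S := by simp [hS]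
  obtain ⟨s, hsB⟩ := hs.right
  have hsS := hs.disjBS s hsB
  have hsA := fun h1 => hs.disjAB s h1 hsB
  have hsY : s ∉ A ∪ S := by simp only [mem_union]; tauto
  have hadj := fun x y => addStar_adj (G := G) (x := x) (y := y) hsY (mem_union_right A haS)
    (mem_union_right A hbS) (mem_union_right A hcS)
  have hsupp : ∀ x y, (addStar G (A ∪ S) s a b c).Adj x y → x ∈ insert s (A ∪ S) := by
    intro x y hxy
    rw [hadj] at hxy
    simp only [mem_insert, mem_union] at *
    grind
  have h1 := hs.card
  have h2 := hs.card_left_union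
  have h3 := card_insert_of_notMem hsY
  have hI := IH _ _ (by omega) ⟨s, mem_insert_self s _⟩ hsupp
    (h.addStar (D := B) (mem_union_right A haS) (mem_union_right A hbS) (mem_union_right A hcS)
      (fun v hv hvB => by
        rcases mem_union.1 hv with hv | hv
        · exact hs.disjAB v hv hvB
        · exact hs.disjBS v hvB hv) hsB (hat a haS) (hat b hbS) (hat c hcS))
  have hN' := hN.addStar hX hs hS hab hsB
  rw [TightBound, arcs_addStar hsY (mem_union_right A haS)
    (mem_union_right A hbS) (mem_union_right A hcS) hab hac hbc] at hI
  refine ⟨by omega, fun heq => ?_⟩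
  obtain ⟨p, hp, hpadj, -⟩ := hI.2 (by omega) hN'
  obtain ⟨z, hz⟩ := hs.left
  have hps : p ≠ s := by
    rintro rfl
    have hzp : z ≠ p := fun e => hsA (e ▸ hz)
    have := hpadj z (by simp [hz]) hzp
    rw [hadj] at this
    have := hs.disjAS z hz
    grind
  have hpS : p ∈ S := by
    have := hpadj s (by simp) hps.symm
    rw [hadj] at this
    grind
  refine ⟨p, hpS, fun v hv hvp => ?_⟩
  have := hpadj v (by simp only [mem_insert]; tauto) hvp
  rw [hadj] at this
  grind

lemma BoundBelow.path_side {G : SimpleGraph V} {X A B S : Finset V} {b : V}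
    (IH : BoundBelow V #X) (h : HasSmallCuts 3 G) (hX : ∀ a b, G.Adj a b → a ∈ X)
    (hN : NoSep 2 G X) (hs : Separation G X A B S) (hS : #S = 3) (hbS : b ∈ S)
    (hind : ∀ s ∈ S, ∀ t ∈ S, ¬ G.Adj s t) (hb : 2 ≤ degIn G B b)
    (hA : arcs (restrictTo G (A ∪ S)) = 4 * #A + 4) :
    (∀ t ∈ S, t ≠ b → degIn G A t = 2) ∧ (degIn G A b = 1 ∨ ∀ v ∈ A, G.Adj b v) := by
  obtain ⟨a, c, hac, hSe⟩ := card_eq_two.1 (by rw [card_erase_of_mem hbS, hS] : #(S.erase b) = 2)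
  have hS' : S = {a, b, c} := by rw [← insert_erase hbS, hSe, insert_comm]
  have hab : a ≠ b := (mem_erase.1 (hSe ▸ (by simp) : a ∈ S.erase b)).1
  have hbc : b ≠ c := (mem_erase.1 (hSe ▸ (by simp) : c ∈ S.erase b)).1.symm
  have haS : a ∈ S := by simp [hS']
  have hcS : c ∈ S := by simp [hS']
  have hadj := fun x y => addPath_adj (G := G) (Y := A ∪ S) (x := x) (y := y) hab hbc
  have hsupp : ∀ x y, (addPath G (A ∪ S) a b c).Adj x y → x ∈ A ∪ S := by
    intro x y hxy
    rw [hadj] at hxy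
    simp only [mem_union] at *
    grind
  have h1 := hs.card
  have h2 := hs.card_left_union
  have h3 := hs.right.card_pos
  have hab' := hind a haS b hbS
  have hbc' := hind b hbS c hcS
  have hI := IH _ _ (by omega) ⟨a, mem_union_right A haS⟩ hsupp
    (h.addPath hN hX hs hS' hab hac hbc hab' hbc' hb)
  have hN' := hN.addPath hX hs hS' hab hbc
  rw [TightBound, arcs_addPath hab hbc hac hab' hbc'] at hI
  obtain ⟨p, hp, hpadj, hpdeg⟩ := hI.2 (by omega) hN'
  have hpa : p ≠ a := by
    rintro rfl
    have := hpadj c (mem_union_right A hcS) hac.symm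
    rw [hadj] at this
    have := hind p haS c hcS
    grind
  have hpc : p ≠ c := by
    rintro rfl
    have := hpadj a (mem_union_right A haS) hac
    rw [hadj] at this
    have := hind p hcS a haS
    grind
  have hdeg : ∀ t, t = a ∨ t = c → degIn G A t = 2 := by
    intro t ht
    have htS : t ∈ S := by rcases ht with rfl | rfl <;> assumption
    have h4 := hpdeg t (mem_union_right A htS) (by rcases ht with rfl | rfl <;> exact Ne.symm ‹_›)
    have h5 : {w ∈ A ∪ S | (addPath G (A ∪ S) a b c).Adj t w} = insert b {w ∈ A | G.Adj t w} := by
      ext w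
      simp only [mem_filter, mem_insert, hadj, mem_union]
      have := hind t htS w
      have := hs.disjAS w
      grind
    rw [degIn, h5, card_insert_of_notMem (by
      simp only [mem_filter, not_and]; intro hbA; exact absurd hbS (hs.disjAS b hbA))] at h4
    unfold degIn
    omega
  refine ⟨fun t ht htb => hdeg t (by rw [hS'] at ht; simp at ht; tauto), ?_⟩
  by_cases hpb : p = b
  · right
    intro v hv
    have hvS := hs.disjAS v hv
    have := hpadj v (mem_union_left S hv) (fun e => hvS (by rw [e, hpb]; exact hbS))
    rw [hadj] at this
    grind
  · left
    have h4 := hpdeg b (mem_union_right A hbS) (Ne.symm hpb)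
    have h5 : {w ∈ A ∪ S | (addPath G (A ∪ S) a b c).Adj b w} =
        insert a (insert c {w ∈ A | G.Adj b w}) := by
      ext w
      simp only [mem_filter, mem_insert, hadj, mem_union]
      have := hind b hbS w
      have := hs.disjAS w
      grind
    have haA := fun h => hs.disjAS a h haS
    have hcA := fun h => hs.disjAS c h hcS
    rw [degIn, h5, card_insert_of_notMem (by simp only [mem_insert, mem_filter, hac]; tauto),
      card_insert_of_notMem (by simp only [mem_filter]; tauto)] at h4
    unfold degIn
    omega

lemma BoundBelow.exists_two_le_degIn {G : SimpleGraph V} {X A B S : Finset V}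
    (IH : BoundBelow V #X) (h : HasSmallCuts 3 G) (hs : Separation G X A B S) (hS : #S = 3)
    (hind : ∀ s ∈ S, ∀ t ∈ S, ¬ G.Adj s t) (hB : arcs (restrictTo G (B ∪ S)) = 4 * #B + 4) :
    ∃ s ∈ S, 2 ≤ degIn G B s := by
  by_contra! hlt
  obtain ⟨a, b, c, hab, hac, hbc, hS'⟩ := card_eq_three.1 hS
  have haS : a ∈ S := by simp [hS']
  have hbS : b ∈ S := by simp [hS']
  have hcS : c ∈ S := by simp [hS']
  have hI := IH.arcs_restrictTo_le h (Y := B) (by have := hs.card; omega) hs.right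
  have hBS : B ∪ S = insert a (insert b (insert c B)) := by
    rw [hS']; ext w; simp only [mem_union, mem_insert, mem_singleton]; tauto
  have haB : a ∉ B := fun h => hs.disjBS a h haS
  have hbB : b ∉ B := fun h => hs.disjBS b h hbS
  have hcB : c ∉ B := fun h => hs.disjBS c h hcS
  have hskip : ∀ s ∈ S, ∀ t ∈ S, ∀ Y, degIn G (insert t Y) s = degIn G Y s := by
    intro s hs' t ht Y
    rw [degIn, filter_insert, if_neg (hind s hs' t ht), degIn]
  rw [hBS, arcs_restrictTo_insert (by simp [hab, hac, haB]),
    arcs_restrictTo_insert (by simp [hbc, hbB]), arcs_restrictTo_insert (by simp [hcB]),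
    hskip a haS b hbS, hskip a haS c hcS, hskip b hbS c hcS] at hB
  have := hlt a haS
  have := hlt b hbS
  have := hlt c hcS
  omega

lemma BoundBelow.isWheel_of_separation {G : SimpleGraph V} {X A B S : Finset V}
    (IH : BoundBelow V #X) (h : HasSmallCuts 3 G) (hX : ∀ a b, G.Adj a b → a ∈ X)
    (hG : arcs G + 4 = 4 * #X) (hN : NoSep 2 G X) (hs : Separation G X A B S) (hS : #S = 3)
    (hA : 2 ≤ #A) (hB : 2 ≤ #B) : IsWheel G X := by
  obtain ⟨a, b, c, hab, hac, hbc, hS'⟩ := card_eq_three.1 hS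
  obtain ⟨hA1, hA2⟩ := IH.star_side h hX hN hs hS' hab hac hbc hB
  obtain ⟨hB1, hB2⟩ := IH.star_side h hX hN hs.symm hS' hab hac hbc hA
  have hadd := hs.arcs_add hX
  have hn := hs.card
  have htri := arcs_restrictTo_triple (G := G) hab hac hbc
  rw [← hS'] at htri
  have hhub : ∀ p ∈ S, (∀ v ∈ S, v ≠ p → G.Adj p v) → 4 ≤ arcs (restrictTo G S) := by
    intro p hp hpadj
    rw [hS'] at hp hpadj
    simp only [mem_insert, mem_singleton] at hp hpadj
    have h1 := hpadj a
    have h2 := hpadj b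
    have h3 := hpadj c
    have := G.adj_comm a b
    have := G.adj_comm a c
    have := G.adj_comm b c
    grind
  have hhub2 : ∀ p ∈ S, (∀ v ∈ S, v ≠ p → G.Adj p v) → ∀ q ∈ S, (∀ v ∈ S, v ≠ q → G.Adj q v) →
      p ≠ q → 6 ≤ arcs (restrictTo G S) := by
    intro p hp hpadj q hq hqadj hpq
    rw [hS'] at hp hpadj hq hqadj
    simp only [mem_insert, mem_singleton] at hp hpadj hq hqadj
    have h1 := hpadj a
    have h2 := hpadj b
    have h3 := hpadj c
    have h1 := hqadj a
    have h2 := hqadj b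
    have h3 := hqadj c
    have := G.adj_comm a b
    have := G.adj_comm a c
    have := G.adj_comm b c
    grind
  have heA := even_arcs (restrictTo G (A ∪ S))
  have heB := even_arcs (restrictTo G (B ∪ S))
  by_cases hfull : arcs (restrictTo G (A ∪ S)) = 4 * #A + 6 ∨
      arcs (restrictTo G (B ∪ S)) = 4 * #B + 6
  · have hσ : 4 ≤ arcs (restrictTo G S) := by
      rcases hfull with h1 | h1
      · obtain ⟨p, hp, hpadj⟩ := hA2 h1
        exact hhub p hp fun v hv => hpadj v (mem_union_right A hv)
      · obtain ⟨p, hp, hpadj⟩ := hB2 h1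
        exact hhub p hp fun v hv => hpadj v (mem_union_right B hv)
    obtain ⟨p, hp, hpadj⟩ := hA2 (by omega)
    obtain ⟨q, hq, hqadj⟩ := hB2 (by omega)
    have hpq : p = q := by
      by_contra hpq
      have := hhub2 p hp (fun v hv => hpadj v (mem_union_right A hv)) q hq
        (fun v hv => hqadj v (mem_union_right B hv)) hpq
      omega
    subst hpq
    refine isWheel_of_adj hX hG ((hs.mem p).2 (by tauto)) (fun w hw hwp => ?_)
      fun w hw => hN.le_degIn hw (by omega)
    rcases (hs.mem w).1 hw with hw | hw | hw
    · exact hpadj w (mem_union_left S hw) hwp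
    · exact hqadj w (mem_union_left S hw) hwp
    · exact hpadj w (mem_union_right A hw) hwp
  · exfalso
    have hA4 : arcs (restrictTo G (A ∪ S)) = 4 * #A + 4 := by omega
    have hB4 : arcs (restrictTo G (B ∪ S)) = 4 * #B + 4 := by omega
    have hσ : arcs (restrictTo G S) = 0 := by omega
    have hind : ∀ s ∈ S, ∀ t ∈ S, ¬ G.Adj s t := by
      intro s hs' t ht hst
      have h1 := arcs_restrictTo_pair (G := G) hst.ne
      rw [if_pos hst] at h1
      have h2 := arcs_mono (G := restrictTo G {s, t}) (H := restrictTo G S) fun x y hxy => by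
        simp only [restrictTo_adj, mem_insert, mem_singleton] at hxy ⊢
        grind
      omega
    have third : ∀ u s, ∃ t ∈ S, t ≠ u ∧ t ≠ s := by
      intro u s
      obtain ⟨t, ht, ht'⟩ := exists_mem_notMem_of_card_lt_card (s := {u, s}) (t := S)
        (by have := card_le_two (a := u) (b := s); omega)
      simp only [mem_insert, mem_singleton, not_or] at ht'
      exact ⟨t, ht, ht'⟩
    obtain ⟨s, hsS, hsB⟩ := IH.exists_two_le_degIn h hs hS hind hB4
    have hA2' := (IH.path_side h hX hN hs hS hsS hind hsB hA4).1
    have hB2' : ∀ u ∈ S, degIn G B u = 2 := by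
      intro u hu
      obtain ⟨t, ht, htu, hts⟩ := third u s
      exact (IH.path_side h hX hN hs.symm hS ht hind (hA2' t ht hts).ge hB4).1 u hu htu.symm
    have hA2'' : ∀ u ∈ S, degIn G A u = 2 := by
      intro u hu
      obtain ⟨t, ht, htu, -⟩ := third u u
      exact (IH.path_side h hX hN hs hS ht hind (hB2' t ht).ge hA4).1 u hu htu.symm
    have hall : ∀ s ∈ S, ∀ v ∈ A ∪ B, G.Adj v s := by
      intro s hs' v hv
      rcases mem_union.1 hv with hv | hv
      · have := (IH.path_side h hX hN hs hS hs' hind (hB2' s hs').ge hA4).2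
        rw [hA2'' s hs'] at this
        exact (this.resolve_left (by omega) v hv).symm
      · have := (IH.path_side h hX hN hs.symm hS hs' hind (hA2'' s hs').ge hB4).2
        rw [hB2' s hs'] at this
        exact (this.resolve_left (by omega) v hv).symm
    have := h.card_common_le hab (A ∪ B) fun v hv =>
      ⟨hall a (by simp [hS']) v hv, hall b (by simp [hS']) v hv⟩
    rw [card_union_of_disjoint (Finset.disjoint_left.2 hs.disjAB)] at this
    omega

lemma BoundBelow.noSep_two {G : SimpleGraph V} {X : Finset V} (IH : BoundBelow V #X)
    (h : HasSmallCuts 3 G) (hX : ∀ a b, G.Adj a b → a ∈ X) (hN : NoSep 1 G X)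
    (hG : 4 * #X ≤ arcs G + 4) : NoSep 2 G X := by
  by_contra hN'
  obtain ⟨A, B, S, hs, hS⟩ := exists_separation_of_not_noSep hN'
  have := hN.lt_card hs
  obtain ⟨u, v, huv, rfl⟩ := card_eq_two.1 (by omega : #S = 2)
  have := IH.arcs_le_of_pair h hX hN hs huv
  omega

lemma BoundBelow.isWheel {G : SimpleGraph V} {X : Finset V} (IH : BoundBelow V #X)
    (h : HasSmallCuts 3 G) (hX : ∀ a b, G.Adj a b → a ∈ X) (hne : X.Nonempty)
    (hN : NoSep 1 G X) (hG : arcs G + 4 = 4 * #X) : IsWheel G X := by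
  have hN2 := IH.noSep_two h hX hN hG.ge
  by_contra hW
  have hex : ∀ v ∈ X, ∃ w ∈ X, w ≠ v ∧ 4 ≤ degIn G X w := by
    intro v hv
    by_contra! hlt
    exact hW (isWheel_of_degIn_le hX hG hv fun w hw hwv => Nat.le_of_lt_succ (hlt w hw hwv))
  obtain ⟨v, hv⟩ := hne
  obtain ⟨x, hx, -, hxd⟩ := hex v hv
  obtain ⟨y, hy, hyx, hyd⟩ := hex x hx
  obtain ⟨A, B, S, hs, hS, hA, hB⟩ := h.exists_separation hN2 hx hy hyx.symm hxd hyd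
  exact hW (IH.isWheel_of_separation h hX hG hN2 hs hS hA hB)

omit [Fintype V] in
lemma NoSep.removeEdge {k : ℕ} {G : SimpleGraph V} {X : Finset V} {x y : V}
    (h : NoSep (k + 1) G X) (hk : k + 3 ≤ #X) : NoSep k (removeEdge G x y) X := by
  intro C T hT hC hC'
  by_contra! hE
  have hE' : ∀ a ∈ X, ∀ b ∈ X, a ∈ C → a ∉ T → b ∉ C → b ∉ T → G.Adj a b →
      a = x ∧ b = y ∨ a = y ∧ b = x := by
    intro a ha b hb h1 h2 h3 h4 h5
    by_contra h6
    exact hE a ha b hb h1 h2 h3 h4 (removeEdge_adj.2 ⟨h5, by tauto⟩)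
  obtain ⟨p, hp, q, hq, hpC, hpT, hqC, hqT, hpq⟩ := h C T (by omega) hC hC'
  have hpq' := hE' p hp q hq hpC hpT hqC hqT hpq
  obtain ⟨w, hw, hw'⟩ := exists_mem_notMem_of_card_lt_card (s := insert p (insert q T)) (t := X)
    (by
      have := card_insert_le p (insert q T)
      have := card_insert_le q T
      omega)
  simp only [mem_insert, not_or] at hw'
  by_cases hwC : w ∈ C
  · obtain ⟨a, ha, b, hb, h1, h2, h3, h4, h5⟩ := h C (insert p T)
      (by have := card_insert_le p T; omega) ⟨w, hw, hwC, by simp [hw']⟩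
      ⟨q, hq, hqC, by simp [hqT, hpq.ne']⟩
    simp only [mem_insert, not_or] at h2 h4
    have := hE' a ha b hb h1 h2.2 h3 h4.2 h5
    grind
  · obtain ⟨a, ha, b, hb, h1, h2, h3, h4, h5⟩ := h C (insert q T)
      (by have := card_insert_le q T; omega) ⟨p, hp, hpC, by simp [hpT, hpq.ne]⟩
      ⟨w, hw, hwC, by simp [hw']⟩
    simp only [mem_insert, not_or] at h2 h4
    have := hE' a ha b hb h1 h2.2 h3 h4.2 h5
    grind

lemma exists_adj_of_arcs_pos {G : SimpleGraph V} (h : 0 < arcs G) : ∃ x y, G.Adj x y := by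
  by_contra! hE
  rw [arcs_eq_sum] at h
  refine h.ne' (Finset.sum_eq_zero fun v _ => ?_)
  rw [degIn, card_eq_zero, filter_eq_empty_iff]
  exact fun w _ => hE v w

lemma arcs_le_card_mul {G : SimpleGraph V} {X : Finset V} (hX : ∀ a b, G.Adj a b → a ∈ X) :
    arcs G ≤ #X * (#X - 1) := by
  rw [arcs_eq_sum_degIn hX, ← smul_eq_mul]
  exact sum_le_card_nsmul _ _ _ fun v hv => Nat.le_sub_one_of_lt (degIn_lt_card hv)

omit [Fintype V] in
lemma HasSmallCuts.not_isWheel_removeEdge {G : SimpleGraph V} {X : Finset V}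
    (h : HasSmallCuts 3 G) (hX : ∀ a b, G.Adj a b → a ∈ X) {x y : V} (hxy : G.Adj x y) :
    ¬ IsWheel (removeEdge G x y) X := by
  rintro ⟨p, hp, hpadj, hpdeg⟩
  have hx := hX _ _ hxy
  have hy := hX _ _ hxy.symm
  have hpx : p ≠ x := by
    rintro rfl
    have := hpadj y hy hxy.ne'
    rw [removeEdge_adj] at this
    tauto
  have hpy : p ≠ y := by
    rintro rfl
    have := hpadj x hx hxy.ne
    rw [removeEdge_adj] at this
    tauto
  have hdeg := hpdeg x hx hpx.symm
  have hxp := removeEdge_adj.1 (hpadj x hx hpx.symm)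
  have hcard : #(insert y ({w ∈ X | (removeEdge G x y).Adj x w}.erase p)) = 3 := by
    rw [card_insert_of_notMem, card_erase_of_mem]
    · unfold degIn at hdeg; omega
    · rw [mem_filter]
      exact ⟨hp, (hpadj x hx hpx.symm).symm⟩
    · simp [removeEdge_adj]
  have hcom := h.card_common_le hpx (insert y ({w ∈ X | (removeEdge G x y).Adj x w}.erase p))
    fun v hv => by
      simp only [mem_insert, mem_erase, mem_filter] at hv
      rcases hv with rfl | ⟨hvp, hvX, hv⟩
      · exact ⟨(removeEdge_adj.1 (hpadj v hy hpy.symm)).1.symm, hxy.symm⟩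
      · exact ⟨(removeEdge_adj.1 (hpadj v hvX hvp)).1.symm, (removeEdge_adj.1 hv).1.symm⟩
  rw [hcard, if_pos hxp.1] at hcom
  omega

lemma BoundBelow.arcs_le {X : Finset V} (IH : BoundBelow V #X) (hne : X.Nonempty) (m : ℕ) :
    ∀ G : SimpleGraph V, arcs G = m → HasSmallCuts 3 G → (∀ a b, G.Adj a b → a ∈ X) →
      arcs G + 4 ≤ 4 * #X := by
  induction m using Nat.strong_induction_on with
  | _ m ihm =>
    intro G hm h hX
    by_contra! hlt
    have hpos := hne.card_pos
    obtain ⟨x, y, hxy⟩ := exists_adj_of_arcs_pos (G := G) (by omega)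
    have hrem := arcs_removeEdge hxy
    have hX' : ∀ a b, (removeEdge G x y).Adj a b → a ∈ X :=
      fun a b hab => hX a b (removeEdge_adj.1 hab).1
    have h' : HasSmallCuts 3 (removeEdge G x y) := h.mono fun a b hab => (removeEdge_adj.1 hab).1
    have hle := ihm _ (by omega) (removeEdge G x y) rfl h' hX'
    have he := even_arcs G
    have hN : NoSep 1 G X := by
      by_contra hN
      obtain ⟨A, B, S, hs, hS⟩ := exists_separation_of_not_noSep hN
      have := IH.arcs_le_of_separation h hX hs hS
      omega
    have hN2 := IH.noSep_two h hX hN (by omega)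
    have h4 : 1 + 3 ≤ #X := by
      have := arcs_le_card_mul hX
      by_contra! h4
      interval_cases #X <;> omega
    exact h.not_isWheel_removeEdge hX hxy
      (IH.isWheel h' hX' hne (hN2.removeEdge h4) (by omega))

lemma boundBelow (n : ℕ) : BoundBelow V n := by
  induction n with
  | zero => intro H Y hY; omega
  | succ n ih =>
    intro H Y hY hne hsupp h
    have IH : BoundBelow V #Y := fun H' Y' hY' => ih H' Y' (by omega)
    exact ⟨IH.arcs_le hne _ H rfl h hsupp, fun hG hN => IH.isWheel h hsupp hne hN hG⟩

lemma HasSmallCuts.arcs_le_of_three {G : SimpleGraph V} [Nonempty V] (h : HasSmallCuts 3 G) :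
    arcs G + 4 ≤ 4 * Fintype.card V :=
  (boundBelow _ G univ (Nat.lt_succ_self _) univ_nonempty (fun a _ _ => mem_univ a) h).1

lemma HasSmallCuts.exists_pair_separation {G : SimpleGraph V} {X : Finset V}
    (h : HasSmallCuts 2 G) (hN : NoSep 1 G X) {x y : V} (hx : x ∈ X) (hy : y ∈ X) (hxy : x ≠ y)
    (hxd : 3 ≤ degIn G X x) : ∃ A B u v, Separation G X A B {u, v} ∧ u ≠ v := by
  suffices h' : ∃ A B S, Separation G X A B S ∧ #S ≤ 2 by
    obtain ⟨A, B, S, hs, hS⟩ := h'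
    have := hN.lt_card hs
    obtain ⟨u, v, huv, rfl⟩ := card_eq_two.1 (by omega : #S = 2)
    exact ⟨A, B, u, v, hs, huv⟩
  obtain ⟨C, T₀, hxC, hxT, hyC, hyT, hE, hk⟩ := h x y hxy
  by_contra! hno
  have hsplit : ∀ T, T₀ ⊆ T → #T ≤ 2 → (¬ G.Adj x y ∨ x ∈ T) → y ∉ T →
      ∀ w ∈ X, w ∈ C → w ∈ T := by
    intro T hT hT2 hxT' hyT' w hw hwC
    by_contra hwT
    have hN2 : ¬ NoSep 2 G X := by
      intro hN2
      obtain ⟨a, ha, b, hb, h1, h2, h3, h4, h5⟩ := hN2 C T hT2 ⟨w, hw, hwC, hwT⟩ ⟨y, hy, hyC, hyT'⟩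
      obtain ⟨rfl, rfl⟩ := hE a b h1 (fun h => h2 (hT h)) h3 (fun h => h4 (hT h)) h5
      tauto
    obtain ⟨A, B, S, hs, hS⟩ := exists_separation_of_not_noSep hN2
    exact absurd hS (not_le.2 (hno A B S hs))
  by_cases hadj : G.Adj x y
  · rw [if_pos hadj] at hk
    have hins := card_insert_le x T₀
    have hC := hsplit (insert x T₀) (subset_insert _ _) (by omega) (by simp)
      (by simp [hyT, hxy.symm])
    have : degIn G X x ≤ #(insert y T₀) := card_le_card fun w hw => by
      simp only [mem_filter] at hw
      have h1 := hC w hw.1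
      have h2 := hE x w hxC hxT
      have := hw.2.ne
      simp only [mem_insert] at *
      grind
    have := card_insert_le y T₀
    omega
  · exact hxT (hsplit T₀ subset_rfl (by omega) (Or.inl hadj) hyT x hx hxC)

lemma HasSmallCuts.arcs_le_of_two_aux (n : ℕ) : ∀ (G : SimpleGraph V) (X : Finset V), #X < n →
    X.Nonempty → (∀ a b, G.Adj a b → a ∈ X) → HasSmallCuts 2 G → arcs G + 3 ≤ 3 * #X := by
  induction n with
  | zero => intro G X h; omega
  | succ n ih =>
    intro G X hn hne hX h
    by_cases hN : NoSep 1 G X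
    · by_cases hex : ∃ v ∈ X, ∀ w ∈ X, w ≠ v → degIn G X w ≤ 2
      · obtain ⟨v, hv, hle⟩ := hex
        rw [arcs_eq_sum_degIn hX, ← add_sum_erase X _ hv]
        have h1 := degIn_lt_card (G := G) hv
        have h2 : ∑ w ∈ X.erase v, degIn G X w ≤ #(X.erase v) • 2 :=
          sum_le_card_nsmul _ _ 2 fun w hw => hle w (mem_of_mem_erase hw) (ne_of_mem_erase hw)
        rw [card_erase_of_mem hv, smul_eq_mul] at h2
        omega
      · push Not at hex
        obtain ⟨v, hv⟩ := hne
        obtain ⟨x, hx, -, hxd⟩ := hex v hv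
        obtain ⟨y, hy, hyx, -⟩ := hex x hx
        obtain ⟨A, B, u, v, hs, huv⟩ := h.exists_pair_separation hN hx hy hyx.symm hxd
        have side : ∀ {A B : Finset V}, Separation G X A B {u, v} →
            arcs (restrictTo G (A ∪ {u, v})) + 2 * (if G.Adj u v then 0 else 1) ≤ 3 * #A + 3 := by
          intro A B hs
          have hu : u ∈ A ∪ {u, v} := by simp
          have hv : v ∈ A ∪ {u, v} := by simp
          have hcard : #({u, v} : Finset V) = 2 := card_pair huv
          have h1 := hs.card
          have h2 := hs.card_left_union
          have h3 := hs.right.card_pos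
          have hat := fun t ht => hN.attached_of_separation hX hs hcard.le (s := t) ht
          have := ih (addEdge (restrictTo G (A ∪ {u, v})) u v) (A ∪ {u, v}) (by omega) ⟨u, hu⟩
            (fun a b hab => by
              rw [addEdge_adj, restrictTo_adj] at hab
              grind)
            (h.restrictTo_addEdge (D := B) huv hu hv (fun w hw hwB => by
              have := hs.disjAB w
              have := hs.disjBS w hwB
              grind) hs.right (hat u (by simp)) (hat v (by simp)))
          rw [arcs_addEdge_restrictTo huv hu hv] at this
          omega
        have hA := side hs
        have hB := side hs.symm
        have hadd := hs.arcs_add hX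
        have h1 := hs.card
        rw [card_pair huv] at h1
        rw [arcs_restrictTo_pair huv] at hadd
        obtain ⟨C, T, huC, huT, hvC, hvT, hE, hk⟩ := h u v huv
        have hmA := hN.one_le_card_inter hX hs.symm huv huC huT hvC hvT hE
        have hmB := hN.one_le_card_inter hX hs huv huC huT hvC hvT hE
        have hdisj := hs.card_inter_add_le T
        split_ifs at * <;> omega
    · obtain ⟨A, B, S, hs, hS⟩ := exists_separation_of_not_noSep hN
      have h1 := hs.card
      have h2 := hs.card_left_union
      have h3 := hs.symm.card_left_union
      have hA := hs.left.card_pos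
      have hB := hs.right.card_pos
      have hI : ∀ Y : Finset V, #Y < n → Y.Nonempty → arcs (restrictTo G Y) + 3 ≤ 3 * #Y :=
        fun Y hY hYn => ih (restrictTo G Y) Y hY hYn (fun _ _ hab => (restrictTo_adj.1 hab).2.1)
          (h.mono fun _ _ hab => (restrictTo_adj.1 hab).1)
      have h4 := hI (A ∪ S) (by omega) (hs.left.mono subset_union_left)
      have h5 := hI (B ∪ S) (by omega) (hs.right.mono subset_union_left)
      have := hs.arcs_add hX
      omega

lemma HasSmallCuts.arcs_le_of_two {G : SimpleGraph V} [Nonempty V] (h : HasSmallCuts 2 G) :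
    arcs G + 3 ≤ 3 * Fintype.card V :=
  HasSmallCuts.arcs_le_of_two_aux _ G univ (Nat.lt_succ_self _) univ_nonempty
    (fun a _ _ => mem_univ a) h

lemma card_le_of_rainbowSet {c : V → ℕ} {T : Finset V} (h : RainbowSet c T) :
    #T ≤ (Set.range c).ncard := by
  rw [← card_image_of_injOn h, ← Set.ncard_coe_finset]
  exact Set.ncard_le_ncard (by simp) (Set.finite_range c)

lemma IsRVDColoring.hasSmallCuts {G : SimpleGraph V} {c : V → ℕ} (h : IsRVDColoring G c) :
    HasSmallCuts (Set.range c).ncard G := by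
  intro x y hxy
  obtain ⟨S, hxS, hyS, hcut, hna, ha⟩ := h x y hxy
  refine ⟨univ.filter fun v => ∃ p : (G.deleteEdges {s(x, y)}).Walk x v, ∀ w ∈ p.support, w ∉ S,
    univ.filter fun v => v ∈ S, ?_, by simpa, ?_, by simpa, ?_, ?_⟩
  · rw [mem_filter]
    exact ⟨mem_univ x, .nil, by simpa⟩
  · rw [mem_filter]
    rintro ⟨-, p, hp⟩
    obtain ⟨v, hv, hvS⟩ := hcut p
    exact hp v hv hvS
  · intro a b haA haT hbA hbT hab
    rw [mem_filter] at haA hbA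
    obtain ⟨-, p, hp⟩ := haA
    simp only [mem_filter, mem_univ, true_and, not_exists] at hbT hbA
    by_cases hdel : (G.deleteEdges {s(x, y)}).Adj a b
    · refine absurd (fun w hw => ?_) (hbA (p.concat hdel))
      rw [SimpleGraph.Walk.support_concat, List.mem_append, List.mem_singleton] at hw
      rcases hw with hw | rfl
      · exact hp w hw
      · exact hbT
    · rw [SimpleGraph.deleteEdges_adj] at hdel
      simp only [hab, true_and, Set.mem_singleton_iff, not_not, Sym2.eq_iff] at hdel
      refine hdel.resolve_right ?_
      rintro ⟨rfl, rfl⟩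
      obtain ⟨v, hv, hvS⟩ := hcut p
      exact hp v hv hvS
  · split_ifs with hadj
    · have key : ∀ z, z ∉ S → RainbowSet c (insert z S) →
          #({v | v ∈ S} : Finset V) + 1 ≤ (Set.range c).ncard := by
        intro z hz hr
        rw [← card_insert_of_notMem (a := z) (by simpa)]
        exact card_le_of_rainbowSet (by simpa)
      rcases ha hadj with hr | hr
      · exact key x hxS hr
      · exact key y hyS hr
    · exact card_le_of_rainbowSet (by simpa using hna hadj)

omit [Fintype V] in
lemma exists_isRVDColoring {G : SimpleGraph V} {k : ℕ} (hk : k ≠ 0) (h : rvd G = k) :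
    ∃ c : V → ℕ, IsRVDColoring G c ∧ (Set.range c).ncard = k := by
  subst h
  exact Nat.sInf_mem (Nat.nonempty_of_sInf_eq_succ (Nat.succ_pred_eq_of_ne_zero hk).symm)

lemma ncard_edgeSet_le_of_rvd {G : SimpleGraph V} [Nonempty V] {k : ℕ} (hk : k = 2 ∨ k = 3)
    (h : rvd G = k) : G.edgeSet.ncard ≤ (k + 1) * (Fintype.card V - 1) / 2 := by
  obtain ⟨c, hc, hck⟩ := exists_isRVDColoring (by omega) h
  have hcut := hck ▸ hc.hasSmallCuts
  have harcs := arcs_eq_two_mul G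
  rcases hk with rfl | rfl
  · have := hcut.arcs_le_of_two
    omega
  · have := hcut.arcs_le_of_three
    omega

omit [Fintype V] in
/-- A coloring that is injective on the neighbourhood of every vertex but one is a rainbow
vertex-disconnection coloring. -/
lemma isRVDColoring_of_injOn {G : SimpleGraph V} {c : V → ℕ} {z : V}
    (h : ∀ v, v ≠ z → Set.InjOn c (G.neighborSet v)) : IsRVDColoring G c := by
  have step : ∀ {H : SimpleGraph V} {a b : V}, a ≠ b → ∀ p : H.Walk a b,
      ∃ v ∈ p.support, H.Adj a v := by
    intro H a b hab p
    cases p with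
    | nil => exact absurd rfl hab
    | cons hav q => exact ⟨_, by simp, hav⟩
  intro x y hxy
  by_cases hx : x = z
  · have hy : y ≠ z := fun hy => hxy (hx.trans hy.symm)
    refine ⟨G.neighborSet y \ {x}, by simp, by simp, fun p => ?_,
      fun _ => (h y hy).mono Set.sdiff_subset, fun hadj => Or.inl ?_⟩
    · obtain ⟨v, hv, hyv⟩ := step hxy.symm p.reverse
      rw [SimpleGraph.deleteEdges_adj] at hyv
      refine ⟨v, by simpa using hv, hyv.1, ?_⟩
      rintro rfl
      exact hyv.2 (by simp [Sym2.eq_swap])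
    · rw [Set.insert_sdiff_singleton, Set.insert_eq_of_mem (by simpa using hadj.symm)]
      exact h y hy
  · refine ⟨G.neighborSet x \ {y}, by simp, by simp, fun p => ?_,
      fun _ => (h x hx).mono Set.sdiff_subset, fun hadj => Or.inr ?_⟩
    · obtain ⟨v, hv, hxv⟩ := step hxy p
      rw [SimpleGraph.deleteEdges_adj] at hxv
      refine ⟨v, hv, hxv.1, ?_⟩
      rintro rfl
      exact hxv.2 (by simp)
    · rw [Set.insert_sdiff_singleton, Set.insert_eq_of_mem (by simpa using hadj)]
      exact h x hx

lemma rvd_eq_of_card_common {G : SimpleGraph V} {c : V → ℕ} (hc : IsRVDColoring G c)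
    {x y : V} (hxy : G.Adj x y) (C : Finset V) (hC : ∀ v ∈ C, G.Adj v x ∧ G.Adj v y)
    (hck : ∀ v, c v < #C + 1) : rvd G = #C + 1 := by
  have hlow : ∀ c : V → ℕ, IsRVDColoring G c → #C + 1 ≤ (Set.range c).ncard := fun c hc => by
    have := hc.hasSmallCuts.card_common_le hxy.ne C hC
    rwa [if_pos hxy] at this
  unfold rvd
  refine le_antisymm (le_trans (Nat.sInf_le ⟨c, hc, rfl⟩) ?_)
    (le_csInf ⟨(Set.range c).ncard, c, hc, rfl⟩ ?_)
  swap
  · rintro _ ⟨c', hc', rfl⟩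
    exact hlow c' hc'
  rw [← card_range (#C + 1), ← Set.ncard_coe_finset]
  refine Set.ncard_le_ncard ?_ (finite_toSet _)
  rintro _ ⟨v, rfl⟩
  simpa using hck v

omit [Fintype V] in
lemma connected_of_forall_adj {G : SimpleGraph V} {z : V} (h : ∀ v, v ≠ z → G.Adj z v) :
    G.Connected := by
  refine SimpleGraph.connected_iff_exists_forall_reachable G |>.2 ⟨z, fun v => ?_⟩
  by_cases hv : v = z
  · exact hv ▸ .refl _
  · exact (h v hv).reachable

lemma le_degIn_of_subset {G : SimpleGraph V} {v : V} (C : Finset V) (h : ∀ w ∈ C, G.Adj v w) :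
    #C ≤ degIn G univ v :=
  card_le_card fun w hw => mem_filter.2 ⟨mem_univ w, h w hw⟩

lemma exists_rvd_eq_two {n : ℕ} (hn : 3 ≤ n) : ∃ G : SimpleGraph (Fin n),
    G.Connected ∧ rvd G = 2 ∧ G.edgeSet.ncard = 3 * (n - 1) / 2 := by
  let G : SimpleGraph (Fin n) :=
    { Adj := fun a b => a ≠ b ∧ (a.val = 0 ∨ b.val = 0 ∨ (a.val - 1) / 2 = (b.val - 1) / 2)
      symm := ⟨fun a b h => ⟨h.1.symm, by omega⟩⟩
      loopless := ⟨fun a h => h.1 rfl⟩ }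
  have hadj : ∀ a b, G.Adj a b ↔
      a.val ≠ b.val ∧ (a.val = 0 ∨ b.val = 0 ∨ (a.val - 1) / 2 = (b.val - 1) / 2) := by
    intro a b
    simp only [G, ne_eq, Fin.ext_iff]
  let z : Fin n := ⟨0, by omega⟩
  have hz : ∀ v, v ≠ z → G.Adj z v := fun v hv =>
    (hadj z v).2 ⟨fun h => hv (Fin.ext h.symm), by simp [z]⟩
  have hne : ∀ v, v ≠ z → v.val ≠ 0 := fun v hv h => hv (Fin.ext h)
  have hcol : IsRVDColoring G (fun v : Fin n => if v.val = 0 then 0 else 1) := by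
    refine isRVDColoring_of_injOn (z := z) fun v hv a ha b hb hab => ?_
    rw [SimpleGraph.mem_neighborSet, hadj] at ha hb
    have := hne v hv
    refine Fin.ext ?_
    split_ifs at hab <;> omega
  have hrvd : rvd G = 2 :=
    rvd_eq_of_card_common hcol (x := z) (y := ⟨1, by omega⟩) ((hadj _ _).2 (by simp [z]))
      {⟨2, by omega⟩} (by simp [hadj, z]) (by intro v; split_ifs <;> simp)
  have : Nonempty (Fin n) := ⟨z⟩
  refine ⟨G, connected_of_forall_adj hz, hrvd, le_antisymm ?_ ?_⟩
  · simpa using ncard_edgeSet_le_of_rvd (Or.inl rfl) hrvd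
  · have h1 := arcs_eq_two_mul G
    rw [arcs_eq_sum, ← add_sum_erase univ _ (mem_univ z)] at h1
    have h2 := degIn_of_adj (mem_univ z) fun w _ hw => hz w hw
    rw [card_univ, Fintype.card_fin] at h2
    let l : Fin n := ⟨n - 1, by omega⟩
    have h3 : ∀ v ∈ univ.erase z, 2 ≤ degIn G univ v + (if v = l then 1 else 0) := by
      intro v hv
      have hv0 := hne v (ne_of_mem_erase hv)
      have hvn := v.isLt
      split_ifs with hvl
      · have := le_degIn_of_subset (G := G) (v := v) {z} (by simp [hadj, z, hv0])
        simpa using this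
      · have hvl : v.val ≠ n - 1 := fun h => hvl (Fin.ext h)
        obtain ⟨w, hw⟩ : ∃ w : Fin n, w.val = v.val - 1 + 2 * (v.val % 2) :=
          ⟨⟨_, by omega⟩, rfl⟩
        have hzw : z ≠ w := by
          intro h
          have : w.val = 0 := by rw [← h]
          omega
        have := le_degIn_of_subset (G := G) (v := v) {z, w} (by
          intro u hu
          rw [mem_insert, mem_singleton] at hu
          rcases hu with rfl | rfl
          · simp [hadj, z, hv0]
          · rw [hadj]
            rcases Nat.mod_two_eq_zero_or_one v.val <;> omega)
        rwa [card_pair hzw] at this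
    have h4 := card_nsmul_le_sum (univ.erase z) _ 2 h3
    rw [sum_add_distrib, sum_ite_eq', card_erase_of_mem (mem_univ z), card_univ, Fintype.card_fin,
      smul_eq_mul] at h4
    split_ifs at h4 <;> omega

lemma exists_rvd_eq_three {n : ℕ} (hn : 5 ≤ n) (hn4 : n % 4 = 1) : ∃ G : SimpleGraph (Fin n),
    G.Connected ∧ rvd G = 3 ∧ G.edgeSet.ncard = 2 * (n - 1) := by
  let G : SimpleGraph (Fin n) :=
    { Adj := fun a b => a ≠ b ∧ (a.val = 0 ∨ b.val = 0 ∨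
        (a.val - 1) / 4 = (b.val - 1) / 4 ∧ (a.val + b.val) % 2 = 1)
      symm := ⟨fun a b h => ⟨h.1.symm, by omega⟩⟩
      loopless := ⟨fun a h => h.1 rfl⟩ }
  have hadj : ∀ a b, G.Adj a b ↔ a.val ≠ b.val ∧ (a.val = 0 ∨ b.val = 0 ∨
      (a.val - 1) / 4 = (b.val - 1) / 4 ∧ (a.val + b.val) % 2 = 1) := by
    intro a b
    simp only [G, ne_eq, Fin.ext_iff]
  let z : Fin n := ⟨0, by omega⟩
  have hz : ∀ v, v ≠ z → G.Adj z v := fun v hv =>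
    (hadj z v).2 ⟨fun h => hv (Fin.ext h.symm), by simp [z]⟩
  have hne : ∀ v, v ≠ z → v.val ≠ 0 := fun v hv h => hv (Fin.ext h)
  have hcol : IsRVDColoring G
      (fun v : Fin n => if v.val = 0 then 0 else 1 + (v.val - 1) % 4 / 2) := by
    refine isRVDColoring_of_injOn (z := z) fun v hv a ha b hb hab => ?_
    rw [SimpleGraph.mem_neighborSet, hadj] at ha hb
    have := hne v hv
    refine Fin.ext ?_
    split_ifs at hab <;> omega
  have h24 : #({⟨2, by omega⟩, ⟨4, by omega⟩} : Finset (Fin n)) = 2 := card_pair (by simp)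
  have hrvd : rvd G = 3 := by
    have := rvd_eq_of_card_common hcol (x := z) (y := ⟨1, by omega⟩) ((hadj _ _).2 (by simp [z]))
      {⟨2, by omega⟩, ⟨4, by omega⟩} (by simp [hadj, z])
      (by intro v; rw [h24]; split_ifs <;> omega)
    rwa [h24] at this
  have : Nonempty (Fin n) := ⟨z⟩
  refine ⟨G, connected_of_forall_adj hz, hrvd, le_antisymm ?_ ?_⟩
  · have := ncard_edgeSet_le_of_rvd (Or.inr rfl) hrvd
    rw [Fintype.card_fin] at this
    omega
  · have h1 := arcs_eq_two_mul G
    rw [arcs_eq_sum, ← add_sum_erase univ _ (mem_univ z)] at h1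
    have h2 := degIn_of_adj (mem_univ z) fun w _ hw => hz w hw
    rw [card_univ, Fintype.card_fin] at h2
    have h3 : ∀ v ∈ univ.erase z, 3 ≤ degIn G univ v := by
      intro v hv
      have hv0 := hne v (ne_of_mem_erase hv)
      have hvn := v.isLt
      obtain ⟨w, hw⟩ : ∃ w : Fin n, w.val = (v.val - 1) / 4 * 4 + 1 + v.val % 2 :=
        ⟨⟨_, by omega⟩, rfl⟩
      obtain ⟨w', hw'⟩ : ∃ w : Fin n, w.val = (v.val - 1) / 4 * 4 + 3 + v.val % 2 :=
        ⟨⟨_, by omega⟩, rfl⟩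
      have hzw : z ≠ w := fun h => by
        have : w.val = 0 := by rw [← h]
        omega
      have hzw' : z ≠ w' := fun h => by
        have : w'.val = 0 := by rw [← h]
        omega
      have hww' : w ≠ w' := fun h => by
        rw [h] at hw
        omega
      have := le_degIn_of_subset (G := G) (v := v) {z, w, w'} (by
        intro u hu
        rw [mem_insert, mem_insert, mem_singleton] at hu
        rcases hu with rfl | rfl | rfl
        · simp [hadj, z, hv0]
        · rw [hadj]
          omega
        · rw [hadj]
          omega)
      rwa [card_eq_three.2 ⟨z, w, w', hzw, hzw', hww', rfl⟩] at this
    have h4 : #(univ.erase z) • 3 ≤ ∑ v ∈ univ.erase z, degIn G univ v :=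
      card_nsmul_le_sum _ _ 3 h3
    rw [card_erase_of_mem (mem_univ z), card_univ, Fintype.card_fin, smul_eq_mul] at h4
    omega

end Bounds

end ThreePaths

/-- For `k ∈ {2, 3}`, every connected graph `G` of order `n` with `rvd G = k` has at
most `⌊(k+1)(n-1)/2⌋` edges; this is sharp for `k = 2` and every `n ≥ 3`, and for
`k = 3` and every `n ≥ 5` with `n ≡ 1 (mod 4)`. -/
theorem stmt18 :
    (∀ k ∈ ({2, 3} : Set ℕ), ∀ (n : ℕ) (G : SimpleGraph (Fin n)),
      G.Connected → rvd G = k → G.edgeSet.ncard ≤ (k + 1) * (n - 1) / 2) ∧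
    (∀ n : ℕ, 3 ≤ n → ∃ G : SimpleGraph (Fin n),
      G.Connected ∧ rvd G = 2 ∧ G.edgeSet.ncard = 3 * (n - 1) / 2) ∧
    (∀ n : ℕ, 5 ≤ n → n % 4 = 1 → ∃ G : SimpleGraph (Fin n),
      G.Connected ∧ rvd G = 3 ∧ G.edgeSet.ncard = 2 * (n - 1)) := by
  refine ⟨?_, fun n hn => exists_rvd_eq_two hn, fun n hn h4 => exists_rvd_eq_three hn h4⟩
  rintro k hk n G hG h
  have := hG.nonempty
  simpa using ncard_edgeSet_le_of_rvd (by simpa using hk) h
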